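/- arXiv:math/0109144 — 2 statements merged into one kernel-verified Lean document; each statement's English description precedes it below -/
import Mathlib

section
/- Let κ be a field of characteristic ≠ 2 with fixed t-coordinate on the projective line, K₀ = κ(t), and for a ∈ κ let K_a = K₀(√(1/(t-a))). If S ⊂ κ is a finite set of cardinality n > 0, then the extensions K_a|K₀ for a ∈ S are linearly disjoint over K₀, and their compositum K_S is a function field of one variable over κ of genus g_n = 2^{n-2}(n-3) + 1 (for n ≥ 2). -/
set_option synthInstance.maxHeartbeats 1000000
set_option maxHeartbeats 1000000

section Genus

variable (κ K : Type) [Field κ] [Field K] [Algebra κ K]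

/-- A place of a function field `K|κ` is a proper valuation subring of `K`
containing the constants `κ`. -/
def IsPlace (O : ValuationSubring K) : Prop :=
  (∀ c : κ, algebraMap κ K c ∈ O) ∧ O.toSubring ≠ ⊤

/-- A uniformizer of a valuation subring `O` of `K` is an element of `O`
generating the maximal ideal of `O`. -/
def IsUniformizer (O : ValuationSubring K) (π : K) : Prop :=
  ∃ h : π ∈ O, Ideal.span {(⟨π, h⟩ : O)} = IsLocalRing.maximalIdeal O

/-- The Riemann–Roch space `L(D)` of a divisor `D` (a finitely supported `ℤ`-valued
function on the places of `K|κ`): the space of all `f ∈ K` with `v_O(f) ≥ -D(O)`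
for every place `O`, as a `κ`-subspace of `K`. -/
def RRspace (D : {O : ValuationSubring K // IsPlace κ K O} →₀ ℤ) : Submodule κ K where
  carrier := {f | ∀ (O : {O : ValuationSubring K // IsPlace κ K O}) (π : K),
    IsUniformizer K O.1 π → π ^ (D O) * f ∈ O.1}
  add_mem' := fun {a b} ha hb O π hπ => by
    have h := add_mem (ha O π hπ) (hb O π hπ)
    rwa [← mul_add] at h
  zero_mem' := fun O π hπ => by simpa using zero_mem O.1
  smul_mem' := fun c f hf O π hπ => by
    obtain ⟨hconst, -⟩ := O.2
    rw [Algebra.smul_def]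
    have h := mul_mem (hconst c) (hf O π hπ)
    rwa [mul_left_comm] at h

/-- The degree of a divisor. -/
def divDegree (D : {O : ValuationSubring K // IsPlace κ K O} →₀ ℤ) : ℤ :=
  D.sum fun _ n => n

/-- The genus of a function field of one variable `K|κ` (Chevalley's definition):
the supremum over all divisors `D` of `deg D - ℓ(D) + 1`, where
`ℓ(D) = dim_κ L(D)`. -/
noncomputable def genusZ : ℤ :=
  sSup {m : ℤ | ∃ D : {O : ValuationSubring K // IsPlace κ K O} →₀ ℤ,
    m = divDegree κ K D - Module.finrank κ (RRspace κ K D) + 1}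

end Genus

section Places

variable {K : Type} [Field K]

theorem isUniformizer_iff {O : ValuationSubring K} {π : K} :
    IsUniformizer K O π ↔
      O.valuation π < 1 ∧ ∀ x, O.valuation x < 1 → O.valuation x ≤ O.valuation π := by
  constructor
  · rintro ⟨h, hspan⟩
    have hmem : (⟨π, h⟩ : O) ∈ IsLocalRing.maximalIdeal O :=
      hspan ▸ Ideal.mem_span_singleton_self _
    refine ⟨(O.valuation_lt_one_iff _).1 hmem, fun x hx => ?_⟩
    have hxO : x ∈ O := O.mem_of_valuation_le_one x hx.le
    have hxm : (⟨x, hxO⟩ : O) ∈ IsLocalRing.maximalIdeal O := (O.valuation_lt_one_iff _).2 hx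
    rw [← hspan, Ideal.mem_span_singleton'] at hxm
    obtain ⟨a, ha⟩ := hxm
    exact (O.valuation_le_iff x π).2 ⟨a, congrArg Subtype.val ha⟩
  · rintro ⟨h1, h2⟩
    have h : π ∈ O := O.mem_of_valuation_le_one π h1.le
    refine ⟨h, le_antisymm ?_ fun x hx => ?_⟩
    · rw [Ideal.span_singleton_le_iff_mem]
      exact (O.valuation_lt_one_iff _).2 h1
    · obtain ⟨a, ha⟩ := (O.valuation_le_iff _ _).1 (h2 x ((O.valuation_lt_one_iff _).1 hx))
      exact Ideal.mem_span_singleton'.2 ⟨a, Subtype.ext ha⟩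

theorem IsUniformizer.valuation_eq {O : ValuationSubring K} {π ϖ : K}
    (h : IsUniformizer K O π) (h' : IsUniformizer K O ϖ) : O.valuation π = O.valuation ϖ := by
  rw [isUniformizer_iff] at h h'
  exact le_antisymm (h'.2 _ h.1) (h.2 _ h'.1)

theorem exists_one_lt_valuation {O : ValuationSubring K} (hO : O.toSubring ≠ ⊤) :
    ∃ x, 1 < O.valuation x := by
  by_contra! h
  exact hO (top_unique fun x _ => O.mem_of_valuation_le_one x (h x))

theorem IsUniformizer.ne_zero {O : ValuationSubring K} (hO : O.toSubring ≠ ⊤) {π : K}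
    (h : IsUniformizer K O π) : π ≠ 0 := by
  rintro rfl
  obtain ⟨x, hx⟩ := exists_one_lt_valuation hO
  have hx0 : O.valuation x ≠ 0 := (zero_lt_one.trans hx).ne'
  have h2 := (isUniformizer_iff.1 h).2 x⁻¹ (by
    rw [map_inv₀]; exact inv_lt_one_of_one_lt₀ hx)
  rw [map_zero, map_inv₀, le_zero_iff, inv_eq_zero] at h2
  exact hx0 h2

variable {κ : Type} [Field κ] [Algebra κ K]

theorem IsPlace.valuation_algebraMap_le_one {O : ValuationSubring K} (hO : IsPlace κ K O) (c : κ) :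
    O.valuation (algebraMap κ K c) ≤ 1 :=
  (O.valuation_le_one_iff _).2 (hO.1 c)

theorem IsPlace.valuation_algebraMap {O : ValuationSubring K} (hO : IsPlace κ K O) {c : κ}
    (hc : c ≠ 0) : O.valuation (algebraMap κ K c) = 1 := by
  refine le_antisymm (hO.valuation_algebraMap_le_one c) ?_
  have h := hO.valuation_algebraMap_le_one c⁻¹
  rwa [map_inv₀, map_inv₀, inv_le_one₀] at h
  exact (Valuation.pos_iff _).2 (by simpa using hc)

/-- A place is integrally closed: it contains every element integral over a subring. -/
theorem ValuationSubring.mem_of_isIntegral' {A : Type} [CommRing A] [Algebra A K]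
    (O : ValuationSubring K) (hA : ∀ a : A, algebraMap A K a ∈ O) {x : K} (hx : IsIntegral A x) :
    x ∈ O := by
  let f : A →+* O := (algebraMap A K).codRestrict O.toSubring hA
  have hx' : IsIntegral O x := by
    obtain ⟨p, hp, hpx⟩ := hx
    refine ⟨p.map f, hp.map f, ?_⟩
    rw [Polynomial.eval₂_map]
    exact hpx
  obtain ⟨y, rfl⟩ := IsIntegrallyClosed.isIntegral_iff.1 hx'
  exact y.2

end Places

section RiemannRoch

variable {κ K : Type} [Field κ] [Field K] [Algebra κ K]

local notation "Pl" => {O : ValuationSubring K // IsPlace κ K O}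

theorem mem_RRspace_iff {D : Pl →₀ ℤ} {f : K} : f ∈ RRspace κ K D ↔
    ∀ (O : Pl) (π : K), IsUniformizer K O.1 π →
      O.1.valuation π ^ (D O) * O.1.valuation f ≤ 1 := by
  simp only [← map_zpow₀, ← map_mul, ValuationSubring.valuation_le_one_iff]
  rfl

theorem RRspace_mono {D D' : Pl →₀ ℤ} (h : D ≤ D') : RRspace κ K D ≤ RRspace κ K D' := by
  intro f hf
  rw [mem_RRspace_iff] at hf ⊢
  intro O π hπ
  refine le_trans ?_ (hf O π hπ)
  gcongr ?_ * _
  have h0 : 0 < O.1.valuation π := (Valuation.pos_iff _).2 (hπ.ne_zero O.2.2)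
  exact zpow_le_zpow_right_of_le_one₀ h0 (isUniformizer_iff.1 hπ).1.le (h O)

variable (κ K) in
/-- Every place is discrete with residue field `κ`. -/
def PlacesRational : Prop :=
  ∀ O : Pl, (∃ π, IsUniformizer K O.1 π) ∧
    ∀ u, O.1.valuation u ≤ 1 → ∃ c : κ, O.1.valuation (u - algebraMap κ K c) < 1

theorem divDegree_add (D E : Pl →₀ ℤ) :
    divDegree κ K (D + E) = divDegree κ K D + divDegree κ K E :=
  Finsupp.sum_add_index' (fun _ => rfl) (fun _ _ _ => rfl)

theorem divDegree_single (O : Pl) (m : ℤ) : divDegree κ K (Finsupp.single O m) = m :=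
  Finsupp.sum_single_index rfl

theorem divDegree_smul (m : ℤ) (D : Pl →₀ ℤ) : divDegree κ K (m • D) = m * divDegree κ K D := by
  unfold divDegree
  rw [Finsupp.sum_smul_index' (fun _ => rfl), Finsupp.mul_sum]
  rfl

theorem exists_RRspace_add_single_le (hP : PlacesRational κ K) (D : Pl →₀ ℤ) (P : Pl) :
    ∃ f₀, RRspace κ K (D + Finsupp.single P 1) ≤ RRspace κ K D ⊔ Submodule.span κ {f₀} := by
  obtain ⟨⟨π, hπ⟩, hres⟩ := hP P
  have hπ0 : π ≠ 0 := hπ.ne_zero P.2.2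
  have hv0 : P.1.valuation π ≠ 0 := (Valuation.ne_zero_iff _).2 hπ0
  set v := P.1.valuation with hv
  have key : ∀ f ∈ RRspace κ K (D + Finsupp.single P 1), v (π ^ (D P + 1) * f) < 1 →
      f ∈ RRspace κ K D := by
    intro f hf h1
    rw [mem_RRspace_iff] at hf ⊢
    intro O ϖ hϖ
    by_cases hO : O = P
    · subst hO
      rw [hϖ.valuation_eq hπ]
      have := (isUniformizer_iff.1 hπ).2 _ h1
      rw [map_mul, map_zpow₀, zpow_add_one₀ hv0, mul_right_comm] at this
      exact (mul_le_iff_le_one_left (zero_lt_iff.2 hv0)).1 this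
    · simpa [Finsupp.single_apply, Ne.symm hO] using hf O ϖ hϖ
  have hle : ∀ f ∈ RRspace κ K (D + Finsupp.single P 1), v (π ^ (D P + 1) * f) ≤ 1 := by
    intro f hf
    simpa using mem_RRspace_iff.1 hf P π hπ
  by_cases hall : ∀ f ∈ RRspace κ K (D + Finsupp.single P 1), v (π ^ (D P + 1) * f) < 1
  · exact ⟨0, fun f hf => Submodule.mem_sup_left (key f hf (hall f hf))⟩
  · push Not at hall
    obtain ⟨f₀, hf₀, h₀⟩ := hall
    refine ⟨f₀, fun f hf => ?_⟩
    have h₀' : v (π ^ (D P + 1) * f₀) = 1 := le_antisymm (hle f₀ hf₀) h₀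
    have hf₀0 : f₀ ≠ 0 := by rintro rfl; simp at h₀'
    obtain ⟨c, hc⟩ := hres (f / f₀) (by
      have := hle f hf
      rw [map_mul] at this h₀'
      have h3 : v (f / f₀) = v (π ^ (D P + 1)) * v f := by
        have : v f₀ ≠ 0 := (Valuation.ne_zero_iff _).2 hf₀0
        rw [map_div₀, div_eq_iff this, mul_right_comm, h₀', one_mul]
      rw [h3]; exact this)
    have hdec : f = (f - c • f₀) + c • f₀ := by ring
    rw [hdec]
    refine Submodule.add_mem_sup (key _ (sub_mem hf (Submodule.smul_mem _ _ hf₀)) ?_)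
      (Submodule.smul_mem _ _ (Submodule.mem_span_singleton_self _))
    have h4 : π ^ (D P + 1) * (f - c • f₀) =
        (π ^ (D P + 1) * f₀) * (f / f₀ - algebraMap κ K c) := by
      rw [Algebra.smul_def]; field_simp
    rw [h4, map_mul, h₀', one_mul]
    exact hc

theorem finrank_RRspace_add_single_le (hP : PlacesRational κ K) (D : Pl →₀ ℤ) (P : Pl)
    [FiniteDimensional κ (RRspace κ K (D + Finsupp.single P 1))] :
    Module.finrank κ (RRspace κ K (D + Finsupp.single P 1)) ≤
      Module.finrank κ (RRspace κ K D) + 1 := by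
  obtain ⟨f₀, hf₀⟩ := exists_RRspace_add_single_le hP D P
  have hfd : FiniteDimensional κ (RRspace κ K D) :=
    Submodule.finiteDimensional_of_le (S₂ := RRspace κ K (D + Finsupp.single P 1))
      (RRspace_mono (by simp [Finsupp.single_nonneg]))
  calc _ ≤ Module.finrank κ ↥(RRspace κ K D ⊔ Submodule.span κ {f₀}) :=
        Submodule.finrank_mono hf₀
    _ ≤ Module.finrank κ (RRspace κ K D) + Module.finrank κ (Submodule.span κ {f₀}) :=
        Submodule.finrank_add_le_finrank_add_finrank _ _
    _ ≤ _ := by gcongr; simpa using finrank_span_le_card (R := κ) ({f₀} : Set K)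

/-- `deg D - ℓ(D)` is monotone in `D`. -/
theorem divDegree_sub_finrank_mono (hP : PlacesRational κ K) {D D' : Pl →₀ ℤ} (h : D ≤ D')
    [FiniteDimensional κ (RRspace κ K D')] :
    divDegree κ K D - Module.finrank κ (RRspace κ K D) ≤
      divDegree κ K D' - Module.finrank κ (RRspace κ K D') := by
  suffices H : ∀ (n : ℕ) (D : Pl →₀ ℤ), D ≤ D' → (divDegree κ K (D' - D) = n) →
      divDegree κ K D - Module.finrank κ (RRspace κ K D) ≤
        divDegree κ K D' - Module.finrank κ (RRspace κ K D') by
    have h0 : 0 ≤ divDegree κ K (D' - D) := Finset.sum_nonneg fun O _ => by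
      simpa using h O
    exact H _ D h (Int.toNat_of_nonneg h0).symm
  intro n
  induction n with
  | zero =>
    intro D h hn
    have : D' - D = 0 := by
      by_contra hne
      refine absurd hn (ne_of_gt ?_)
      refine Finset.sum_pos (fun O hO => ?_) (Finsupp.support_nonempty_iff.2 hne)
      have h1 := h O
      have h2 := Finsupp.mem_support_iff.1 hO
      simp only [Finsupp.coe_sub, Pi.sub_apply] at h2 ⊢
      omega
    rw [sub_eq_zero] at this
    rw [this]
  | succ n ih =>
    intro D h hn
    have hne : D' - D ≠ 0 := by
      intro h0
      rw [h0] at hn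
      simp [divDegree] at hn
      omega
    obtain ⟨P, hPne⟩ := Finsupp.support_nonempty_iff.2 hne
    have h1 := h P
    have h2 := Finsupp.mem_support_iff.1 hPne
    simp only [Finsupp.coe_sub, Pi.sub_apply] at h2
    have hle : D + Finsupp.single P 1 ≤ D' := by
      intro O
      by_cases hO : O = P
      · subst hO
        simp only [Finsupp.coe_add, Pi.add_apply, Finsupp.single_eq_same]
        omega
      · simpa [Finsupp.single_apply, Ne.symm hO] using h O
    have hfd : FiniteDimensional κ (RRspace κ K (D + Finsupp.single P 1)) :=
      Submodule.finiteDimensional_of_le (RRspace_mono hle)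
    have hdeg : divDegree κ K D' = divDegree κ K (D' - D) + divDegree κ K D := by
      rw [← divDegree_add, sub_add_cancel]
    have hdeg' : divDegree κ K D' = divDegree κ K (D' - (D + Finsupp.single P 1)) +
        (divDegree κ K D + 1) := by
      have h3 := divDegree_add (D' - (D + Finsupp.single P 1)) (D + Finsupp.single P 1)
      rwa [sub_add_cancel, divDegree_add D, divDegree_single] at h3
    have := ih _ hle (by push_cast at hn; omega)
    have h5 := finrank_RRspace_add_single_le hP D P
    rw [divDegree_add, divDegree_single] at this
    omega

/-- `D` is the principal divisor of `h`. -/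
def IsDivisorOf (h : K) (D : Pl →₀ ℤ) : Prop :=
  ∀ (O : Pl) (π : K), IsUniformizer K O.1 π → O.1.valuation h = O.1.valuation π ^ D O

theorem IsDivisorOf.one : IsDivisorOf (1 : K) (0 : Pl →₀ ℤ) := fun O π _ => by simp

theorem IsDivisorOf.mul {f g : K} {D E : Pl →₀ ℤ} (hf : IsDivisorOf f D) (hg : IsDivisorOf g E) :
    IsDivisorOf (f * g) (D + E) := fun O π hπ => by
  have h0 : O.1.valuation π ≠ 0 := (Valuation.ne_zero_iff _).2 (hπ.ne_zero O.2.2)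
  rw [map_mul, hf O π hπ, hg O π hπ, Finsupp.add_apply, zpow_add₀ h0]

theorem IsDivisorOf.pow {f : K} {D : Pl →₀ ℤ} (hf : IsDivisorOf f D) (m : ℕ) :
    IsDivisorOf (f ^ m) ((m : ℤ) • D) := fun O π hπ => by
  rw [map_pow, hf O π hπ, Finsupp.smul_apply, smul_eq_mul, mul_comm, zpow_mul, zpow_natCast]

theorem IsDivisorOf.prod {ι : Type} {s : Finset ι} {f : ι → K} {D : ι → Pl →₀ ℤ}
    (h : ∀ i ∈ s, IsDivisorOf (f i) (D i)) : IsDivisorOf (∏ i ∈ s, f i) (∑ i ∈ s, D i) := by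
  classical
  induction s using Finset.induction_on with
  | empty => simpa using IsDivisorOf.one
  | insert a s ha ih =>
    rw [Finset.prod_insert ha, Finset.sum_insert ha]
    exact (h a (Finset.mem_insert_self a s)).mul
      (ih fun i hi => h i (Finset.mem_insert_of_mem hi))

/-- Multiplication by `h` identifies `L(D + (h))` with `L(D)`. -/
theorem exists_linearEquiv_RRspace {h : K} (h0 : h ≠ 0) {H : Pl →₀ ℤ} (hH : IsDivisorOf h H)
    (D : Pl →₀ ℤ) : Nonempty (RRspace κ K (D + H) ≃ₗ[κ] RRspace κ K D) := by
  let e : K ≃ₗ[κ] K := LinearEquiv.ofBijective (LinearMap.mulLeft κ h)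
    ⟨mul_right_injective₀ h0, fun y => ⟨h⁻¹ * y, by simp [h0]⟩⟩
  have hmap : (RRspace κ K (D + H)).map (e : K →ₗ[κ] K) = RRspace κ K D := by
    have key : ∀ f, h * f ∈ RRspace κ K D ↔ f ∈ RRspace κ K (D + H) := by
      intro f
      simp only [mem_RRspace_iff]
      refine forall_congr' fun O => forall_congr' fun π => forall_congr' fun hπ => ?_
      have hv0 : O.1.valuation π ≠ 0 := (Valuation.ne_zero_iff _).2 (hπ.ne_zero O.2.2)
      rw [map_mul, hH O π hπ, Finsupp.add_apply, zpow_add₀ hv0, mul_assoc]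
    ext y
    constructor
    · rintro ⟨f, hf, rfl⟩
      exact (key f).2 hf
    · intro hy
      refine ⟨h⁻¹ * y, (key _).1 (by simpa [h0] using hy), ?_⟩
      exact mul_inv_cancel_left₀ h0 y
  exact ⟨(e.submoduleMap _).trans (LinearEquiv.ofEq _ _ hmap)⟩

theorem isDivisorOf_sub {s : K} {c : κ} {Z P : Pl →₀ ℤ}
    (hZ : ∀ (O : Pl),
      (¬ O.1.valuation (s - algebraMap κ K c) < 1 → Z O = 0) ∧
      ∀ π, IsUniformizer K O.1 π → O.1.valuation (s - algebraMap κ K c) < 1 →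
        O.1.valuation (s - algebraMap κ K c) = O.1.valuation π ^ Z O)
    (hP : ∀ (O : Pl), (O.1.valuation s ≤ 1 → P O = 0) ∧
      ∀ π, IsUniformizer K O.1 π → 1 < O.1.valuation s →
        O.1.valuation s = O.1.valuation π ^ (-P O)) :
    IsDivisorOf (s - algebraMap κ K c) (Z - P) := by
  intro O π hπ
  have hc := O.2.valuation_algebraMap_le_one c
  rw [Finsupp.sub_apply]
  by_cases h1 : 1 < O.1.valuation s
  · have h2 : O.1.valuation (s - algebraMap κ K c) = O.1.valuation s :=
      Valuation.map_sub_eq_of_lt_left _ (hc.trans_lt h1)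
    rw [(hZ O).1 (by rw [h2]; exact not_lt.2 h1.le), zero_sub, h2]
    exact (hP O).2 π hπ h1
  · rw [(hP O).1 (not_lt.1 h1), sub_zero]
    by_cases h2 : O.1.valuation (s - algebraMap κ K c) < 1
    · exact (hZ O).2 π hπ h2
    · rw [(hZ O).1 h2, zpow_zero]
      exact le_antisymm (Valuation.map_sub_le _ (not_lt.1 h1) hc) (not_lt.1 h2)

end RiemannRoch

section Dedekind

open IsDedekindDomain HeightOneSpectrum

variable {κ K A B : Type} [Field κ] [Field K] [Algebra κ K]
  [CommRing B] [IsDedekindDomain B] [Algebra B K] [IsFractionRing B K]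
  [Algebra κ B] [IsScalarTower κ B K]

theorem isPlace_valuationSubring (w : HeightOneSpectrum B) :
    IsPlace κ K (w.valuation K).valuationSubring := by
  refine ⟨fun c => ?_, fun h => ?_⟩
  · rw [Valuation.mem_valuationSubring_iff, IsScalarTower.algebraMap_apply κ B K]
    exact w.valuation_le_one _
  · have h' : (w.valuation K).valuationSubring = ⊤ := ValuationSubring.toSubring_injective h
    rw [Valuation.valuationSubring_eq_top_iff] at h'
    exact h' inferInstance

theorem valuation_valuationSubring_lt_one_iff (w : HeightOneSpectrum B) (x : K) :
    (w.valuation K).valuationSubring.valuation x < 1 ↔ w.valuation K x < 1 :=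
  (Valuation.isEquiv_valuation_valuationSubring _).symm.lt_one_iff_lt_one

theorem isUniformizer_valuationSubring_iff (w : HeightOneSpectrum B) (π : K) :
    IsUniformizer K (w.valuation K).valuationSubring π ↔
      w.valuation K π = WithZero.exp (-1 : ℤ) := by
  have heq := Valuation.isEquiv_valuation_valuationSubring (w.valuation K)
  rw [isUniformizer_iff, ← heq.lt_one_iff_lt_one]
  simp only [← heq.lt_one_iff_lt_one, ← heq.le_iff_le]
  obtain ⟨ϖ, hϖ⟩ := w.valuation_exists_uniformizer K
  have hlt : WithZero.exp (-1 : ℤ) < 1 := by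
    rw [← WithZero.exp_zero, WithZero.exp_lt_exp]; norm_num
  have hle : ∀ x, w.valuation K x < 1 → w.valuation K x ≤ WithZero.exp (-1 : ℤ) := by
    intro x hx
    by_cases h0 : w.valuation K x = 0
    · rw [h0]; exact zero_le
    · rw [← WithZero.exp_log h0] at hx ⊢
      rw [← WithZero.exp_zero, WithZero.exp_lt_exp] at hx
      rw [WithZero.exp_le_exp]
      omega
  constructor
  · rintro ⟨h1, h2⟩
    exact le_antisymm (hle _ h1) (hϖ ▸ h2 ϖ (hϖ ▸ hlt))
  · intro h
    rw [h]
    exact ⟨hlt, hle⟩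

theorem exists_isUniformizer_valuationSubring (w : HeightOneSpectrum B) :
    ∃ π, IsUniformizer K (w.valuation K).valuationSubring π :=
  (w.valuation_exists_uniformizer K).imp fun π hπ =>
    (isUniformizer_valuationSubring_iff w π).2 hπ

theorem exists_const_valuation_sub_lt_one (w : HeightOneSpectrum B)
    (hres : ∀ b : B, ∃ c : κ, b - algebraMap κ B c ∈ w.asIdeal) {u : K}
    (hu : (w.valuation K).valuationSubring.valuation u ≤ 1) :
    ∃ c : κ, (w.valuation K).valuationSubring.valuation (u - algebraMap κ K c) < 1 := by
  simp only [valuation_valuationSubring_lt_one_iff]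
  rw [ValuationSubring.valuation_le_one_iff, Valuation.mem_valuationSubring_iff] at hu
  obtain ⟨n, ⟨d, hd⟩, hnd⟩ := w.exists_primeCompl_mul_eq_of_integer u hu
  obtain ⟨c₁, h₁⟩ := hres n
  obtain ⟨c₂, h₂⟩ := hres d
  have hd' : d ∉ w.asIdeal := hd
  have hc₂ : c₂ ≠ 0 := by
    rintro rfl
    rw [map_zero, sub_zero] at h₂
    exact hd' h₂
  have hvd : w.valuation K (algebraMap B K d) = 1 := valuation_eq_one_iff_notMem w |>.2 hd'
  have hmem : n * algebraMap κ B c₂ - algebraMap κ B c₁ * d ∈ w.asIdeal := by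
    have : n * algebraMap κ B c₂ - algebraMap κ B c₁ * d =
        (n - algebraMap κ B c₁) * algebraMap κ B c₂ -
          algebraMap κ B c₁ * (d - algebraMap κ B c₂) := by ring
    rw [this]
    exact sub_mem (Ideal.mul_mem_right _ _ h₁) (Ideal.mul_mem_left _ _ h₂)
  have hvc : w.valuation K (algebraMap κ K c₂) = 1 := by
    rw [IsScalarTower.algebraMap_apply κ B K, valuation_eq_one_iff_notMem]
    intro h
    exact hd' (by simpa using add_mem h₂ h)
  refine ⟨c₁ / c₂, ?_⟩
  have hmem' : w.valuation K (algebraMap B K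
      (n * algebraMap κ B c₂ - algebraMap κ B c₁ * d)) < 1 :=
    (valuation_lt_one_iff_mem (K := K) w _).2 hmem
  have hc₂' : algebraMap κ K c₂ ≠ 0 := by simpa using hc₂
  have : algebraMap B K (n * algebraMap κ B c₂ - algebraMap κ B c₁ * d) =
      (u - algebraMap κ K (c₁ / c₂)) * (algebraMap B K d * algebraMap κ K c₂) := by
    simp only [map_sub, map_mul, ← hnd, ← IsScalarTower.algebraMap_apply, map_div₀]
    field_simp
  rwa [this, map_mul, map_mul, hvd, hvc, one_mul, mul_one] at hmem'

end Dedekind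

section DedekindExtension

open IsDedekindDomain HeightOneSpectrum

variable {κ K A B : Type} [Field κ] [Field K] [Algebra κ K] [CommRing A] [CommRing B]
  [Algebra A B] [Module.Finite A B]

theorem exists_heightOneSpectrum_of_place [IsDedekindDomain B] [Algebra B K]
    [IsFractionRing B K] [Algebra A K] [IsScalarTower A B K] (O : ValuationSubring K) (hO : IsPlace κ K O)
    (hA : ∀ a : A, algebraMap A K a ∈ O) {ϖ : A} (hϖ0 : algebraMap A K ϖ ≠ 0)
    (hmax : (Ideal.span {ϖ}).IsMaximal) (hϖ : O.valuation (algebraMap A K ϖ) < 1) :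
    ∃ w : HeightOneSpectrum B, w.asIdeal.LiesOver (Ideal.span {ϖ}) ∧
      (w.valuation K).valuationSubring = O := by
  have hB : ∀ b : B, algebraMap B K b ∈ O := fun b =>
    ValuationSubring.mem_of_isIntegral' O hA
      ((Algebra.IsIntegral.isIntegral (R := A) b).map (IsScalarTower.toAlgHom A B K))
  let f : B →+* O := (algebraMap B K).codRestrict O.toSubring hB
  let Q : Ideal B := (IsLocalRing.maximalIdeal O).comap f
  have hQ : ∀ b, b ∈ Q ↔ O.valuation (algebraMap B K b) < 1 := fun b =>
    O.valuation_lt_one_iff (f b)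
  have hϖQ : algebraMap A B ϖ ∈ Q := by
    rw [hQ, ← IsScalarTower.algebraMap_apply]; exact hϖ
  have hQ0 : Q ≠ ⊥ := by
    intro h
    rw [h, Ideal.mem_bot] at hϖQ
    rw [IsScalarTower.algebraMap_apply A B K, hϖQ, map_zero] at hϖ0
    exact hϖ0 rfl
  let w : HeightOneSpectrum B := ⟨Q, Ideal.comap_isPrime _ _, hQ0⟩
  refine ⟨w, ⟨hmax.eq_of_le ?_ ?_⟩, ?_⟩
  · exact Ideal.comap_ne_top _ w.isPrime.ne_top
  · rw [Ideal.span_singleton_le_iff_mem]; exact hϖQ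
  · rw [← valuationSubringAtPrime_eq_valuationSubring]
    refine ValuationSubring.eq_of_le_of_ne_top _ ?_ (fun h => hO.2 (by rw [h]; rfl))
    rw [valuationSubringAtPrime_eq_valuationSubring]
    intro x hx
    obtain ⟨n, ⟨d, hd⟩, hnd⟩ := w.exists_primeCompl_mul_eq_of_integer x hx
    have hvd : O.valuation (algebraMap B K d) = 1 :=
      le_antisymm ((O.valuation_le_one_iff _).2 (hB d)) (not_lt.1 fun h => hd ((hQ d).2 h))
    rw [← O.valuation_le_one_iff]
    have := (O.valuation_le_one_iff _).2 (hB n)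
    rwa [← hnd, map_mul, hvd, mul_one] at this

variable [Algebra κ A] [Algebra κ B] [IsScalarTower κ A B]

theorem exists_const_sub_mem [IsAlgClosed κ] {ϖ : A}
    (hres : ∀ a : A, ∃ c : κ, a - algebraMap κ A c ∈ Ideal.span {ϖ})
    (Q : Ideal B) [Q.IsPrime] [Q.LiesOver (Ideal.span {ϖ})] (b : B) :
    ∃ c : κ, b - algebraMap κ B c ∈ Q := by
  have hsurj : Function.Surjective (algebraMap κ (A ⧸ Ideal.span {ϖ})) := by
    intro x
    obtain ⟨a, rfl⟩ := Ideal.Quotient.mk_surjective x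
    obtain ⟨c, hc⟩ := hres a
    exact ⟨c, ((Ideal.Quotient.mk_eq_mk_iff_sub_mem _ _).2 hc).symm⟩
  have h1 : Algebra.IsIntegral κ (A ⧸ Ideal.span {ϖ}) :=
    Algebra.IsIntegral.of_surjective (Algebra.ofId κ (A ⧸ Ideal.span {ϖ})) hsurj
  have h2 : Algebra.IsIntegral (A ⧸ Ideal.span {ϖ}) (B ⧸ Q) := inferInstance
  have h3 : Algebra.IsIntegral κ (B ⧸ Q) := Algebra.IsIntegral.trans (A ⧸ Ideal.span {ϖ})
  obtain ⟨c, hc⟩ := (IsAlgClosed.algebraMap_bijective_of_isIntegral (k := κ) (K := B ⧸ Q)).2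
    (Ideal.Quotient.mk Q b)
  exact ⟨c, (Ideal.Quotient.mk_eq_mk_iff_sub_mem _ _).1 hc.symm⟩

theorem inertiaDeg_eq_one_of_residue {ϖ : A} (hmax : (Ideal.span {ϖ}).IsMaximal)
    (Q : Ideal B) [Q.IsPrime] [Q.LiesOver (Ideal.span {ϖ})]
    (h : ∀ b : B, ∃ c : κ, b - algebraMap κ B c ∈ Q) : Q.inertiaDeg A = 1 := by
  have hQ : Q.IsMaximal := Ideal.IsMaximal.of_liesOver_isMaximal Q (Ideal.span {ϖ})
  rw [Ideal.inertiaDeg_eq_of_isMaximal (Ideal.span {ϖ}) Q]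
  let : Field (A ⧸ Ideal.span {ϖ}) := Ideal.Quotient.field _
  rw [← Subalgebra.bot_eq_top_iff_finrank_eq_one, ← top_le_iff]
  rintro x -
  obtain ⟨b, rfl⟩ := Ideal.Quotient.mk_surjective x
  obtain ⟨c, hc⟩ := h b
  rw [Algebra.mem_bot]
  refine ⟨Ideal.Quotient.mk _ (algebraMap κ A c), ?_⟩
  rw [Ideal.Quotient.algebraMap_mk_of_liesOver, ← IsScalarTower.algebraMap_apply]
  exact ((Ideal.Quotient.mk_eq_mk_iff_sub_mem _ _).2 hc).symm

theorem exists_zeros_of_isDedekindDomain [IsAlgClosed κ] [IsDedekindDomain A] [IsDedekindDomain B]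
    [Module.IsTorsionFree A B] [Algebra A K] [Algebra B K] [IsFractionRing B K]
    [IsScalarTower A B K] [IsScalarTower κ B K] {ϖ : A} (hϖ0 : ϖ ≠ 0)
    (hmax : (Ideal.span {ϖ}).IsMaximal)
    (hres : ∀ a : A, ∃ c : κ, a - algebraMap κ A c ∈ Ideal.span {ϖ})
    (hA : ∀ O : ValuationSubring K, IsPlace κ K O → O.valuation (algebraMap A K ϖ) < 1 →
      ∀ a : A, algebraMap A K a ∈ O) :
    (∀ O : ValuationSubring K, IsPlace κ K O → O.valuation (algebraMap A K ϖ) < 1 →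
      (∃ π, IsUniformizer K O π) ∧
        ∀ u, O.valuation u ≤ 1 → ∃ c : κ, O.valuation (u - algebraMap κ K c) < 1) ∧
    ∃ Z : {O : ValuationSubring K // IsPlace κ K O} →₀ ℤ,
      divDegree κ K Z = Module.finrank A B ∧
      ∀ (O : {O : ValuationSubring K // IsPlace κ K O}) (π : K), IsUniformizer K O.1 π →
        (O.1.valuation (algebraMap A K ϖ) < 1 →
          O.1.valuation (algebraMap A K ϖ) = O.1.valuation π ^ Z O) ∧
        (¬ O.1.valuation (algebraMap A K ϖ) < 1 → Z O = 0) := by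
  classical
  have hϖB : algebraMap A B ϖ ≠ 0 := by
    simpa using hϖ0
  have hϖK : algebraMap A K ϖ ≠ 0 := by
    rw [IsScalarTower.algebraMap_apply A B K]
    simpa using hϖ0
  have hp0 : Ideal.span {ϖ} ≠ ⊥ := by simpa using hϖ0
  let p : HeightOneSpectrum A := ⟨Ideal.span {ϖ}, hmax.isPrime, hp0⟩
  have hex := fun O hO h => exists_heightOneSpectrum_of_place (B := B) (κ := κ) O hO (hA O hO h)
    hϖK hmax h
  refine ⟨fun O hO h => ?_, ?_⟩
  · obtain ⟨w, hw, rfl⟩ := hex O hO h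
    have := w.isPrime
    exact ⟨exists_isUniformizer_valuationSubring w, fun u hu =>
      exists_const_valuation_sub_lt_one w (exists_const_sub_mem hres w.asIdeal) hu⟩
  · have : Fintype ((Ideal.span {ϖ}).primesOver B) :=
      (IsDedekindDomain.primesOver_finite (Ideal.span {ϖ}) B).fintype
    have hbot : ∀ q : (Ideal.span {ϖ}).primesOver B, q.1 ≠ ⊥ := fun q =>
      have := q.2.2
      Ideal.ne_bot_of_liesOver_of_ne_bot hp0 q.1
    let W : (Ideal.span {ϖ}).primesOver B → HeightOneSpectrum B := fun q =>
      ⟨q.1, q.2.1, hbot q⟩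
    let P : (Ideal.span {ϖ}).primesOver B → {O : ValuationSubring K // IsPlace κ K O} :=
      fun q => ⟨((W q).valuation K).valuationSubring, isPlace_valuationSubring (W q)⟩
    have hPinj : Function.Injective P := by
      intro q q' h
      have h1 : (W q).valuation K |>.IsEquiv ((W q').valuation K) :=
        (Valuation.isEquiv_iff_valuationSubring _ _).2 (congrArg Subtype.val h)
      exact Subtype.ext (congrArg HeightOneSpectrum.asIdeal
        (eq_of_valuation_isEquiv_valuation h1))
    have hval : ∀ q : (Ideal.span {ϖ}).primesOver B, (W q).valuation K (algebraMap A K ϖ) =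
        WithZero.exp (-1 : ℤ) ^ (q.1.ramificationIdx A) := by
      intro q
      have h1 : q.1.IsPrime := q.2.1
      have h2 : q.1.LiesOver (Ideal.span {ϖ}) := q.2.2
      have h3 : (W q).asIdeal.LiesOver p.asIdeal := h2
      rw [IsScalarTower.algebraMap_apply A B K, valuation_of_algebraMap,
        ← intValuation_liesOver p (W q), p.intValuation_singleton hϖ0 rfl,
        ← Ideal.ramificationIdx'_eq_ramificationIdx (Ideal.span {ϖ}) q.1 hp0]
    refine ⟨∑ q, Finsupp.single (P q) (q.1.ramificationIdx A : ℤ), ?_, ?_⟩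
    · have hdeg : ∀ s : Finset ((Ideal.span {ϖ}).primesOver B),
          divDegree κ K (∑ q ∈ s, Finsupp.single (P q) (q.1.ramificationIdx A : ℤ)) =
            ∑ q ∈ s, (q.1.ramificationIdx A : ℤ) := by
        intro s
        induction s using Finset.induction_on with
        | empty => rfl
        | insert a s ha ih =>
          rw [Finset.sum_insert ha, Finset.sum_insert ha, divDegree_add, divDegree_single, ih]
      rw [hdeg, ← Ideal.sum_ramification_inertia_eq_finrank (Ideal.span {ϖ}) B, Nat.cast_sum]
      refine Finset.sum_congr rfl fun q _ => ?_
      have h1 : q.1.IsPrime := q.2.1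
      have h2 : q.1.LiesOver (Ideal.span {ϖ}) := q.2.2
      rw [inertiaDeg_eq_one_of_residue (κ := κ) hmax q.1 (exists_const_sub_mem hres q.1), mul_one]
    · intro O π hπ
      refine ⟨fun h => ?_, fun h => ?_⟩
      · obtain ⟨w, hw, hwO⟩ := hex O.1 O.2 h
        let q : (Ideal.span {ϖ}).primesOver B := ⟨w.asIdeal, w.isPrime, hw⟩
        obtain rfl : O = P q := Subtype.ext hwO.symm
        rw [Finsupp.finsetSum_apply, Finset.sum_eq_single q
          (fun q' _ hq' => Finsupp.single_eq_of_ne (fun h => hq' (hPinj h.symm)))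
          (fun h => absurd (Finset.mem_univ _) h), Finsupp.single_eq_same, zpow_natCast, ← map_pow]
        have heq := Valuation.isEquiv_valuation_valuationSubring ((W q).valuation K)
        refine heq.eq_iff.1 ?_
        rw [map_pow, hval, (isUniformizer_valuationSubring_iff _ _).1 hπ]
      · rw [Finsupp.finsetSum_apply]
        refine Finset.sum_eq_zero fun q _ => Finsupp.single_eq_of_ne ?_
        rintro rfl
        refine h ?_
        rw [valuation_valuationSubring_lt_one_iff, IsScalarTower.algebraMap_apply A B K]
        refine (valuation_lt_one_iff_mem (K := K) (W q) _).2 ?_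
        have h2 : q.1.LiesOver (Ideal.span {ϖ}) := q.2.2
        exact (Ideal.mem_of_liesOver q.1 (Ideal.span {ϖ}) ϖ).1 (Ideal.mem_span_singleton_self ϖ)

end DedekindExtension

section ZeroDivisor

open IntermediateField
open scoped IntermediateField.algebraAdjoinAdjoin

variable {κ K : Type} [Field κ] [Field K] [Algebra κ K]

theorem isPrincipalIdealRing_adjoin_singleton {s : K} (hs : Transcendental κ s) :
    IsPrincipalIdealRing (Algebra.adjoin κ {s}) := by
  have hinj : Function.Injective (Polynomial.aeval (R := κ) s) :=
    transcendental_iff_injective.1 hs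
  let e : Polynomial κ ≃ₐ[κ] Algebra.adjoin κ {s} :=
    (AlgEquiv.ofInjective _ hinj).trans
      (Subalgebra.equivOfEq _ _ (Algebra.adjoin_singleton_eq_range_aeval κ s).symm)
  exact IsPrincipalIdealRing.of_surjective e.toRingEquiv.toRingHom e.surjective

theorem exists_sub_mem_span_adjoin_singleton (s : K) (a : Algebra.adjoin κ {s}) :
    ∃ c : κ, a - algebraMap κ (Algebra.adjoin κ {s}) c ∈
      Ideal.span {(⟨s, Algebra.self_mem_adjoin_singleton κ s⟩ : Algebra.adjoin κ {s})} := by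
  obtain ⟨a, ha⟩ := a
  obtain ⟨p, rfl⟩ := (AlgHom.mem_range _).1 (Algebra.adjoin_singleton_eq_range_aeval κ s ▸ ha)
  refine ⟨p.coeff 0, Ideal.mem_span_singleton.2
    ⟨⟨Polynomial.aeval s p.divX, Polynomial.aeval_mem_adjoin_singleton κ s⟩, Subtype.ext ?_⟩⟩
  change Polynomial.aeval s p - algebraMap κ K (p.coeff 0) = s * Polynomial.aeval s p.divX
  have h := congrArg (Polynomial.aeval s) p.divX_mul_X_add
  simp only [map_add, map_mul, Polynomial.aeval_X, Polynomial.aeval_C] at h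
  linear_combination -h

theorem span_adjoin_singleton_isMaximal {s : K} (hs : Transcendental κ s) :
    (Ideal.span {(⟨s, Algebra.self_mem_adjoin_singleton κ s⟩ :
      Algebra.adjoin κ {s})}).IsMaximal := by
  rw [Ideal.isMaximal_iff]
  constructor
  · intro h
    obtain ⟨⟨b, hb⟩, h⟩ := Ideal.mem_span_singleton.1 h
    obtain ⟨p, rfl⟩ := (AlgHom.mem_range _).1 (Algebra.adjoin_singleton_eq_range_aeval κ s ▸ hb)
    have h' : (1 : K) = s * Polynomial.aeval s p := congrArg Subtype.val h
    have h2 : Polynomial.aeval s (Polynomial.X * p - 1 : Polynomial κ) = 0 := by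
      simp [← h']
    have h3 := transcendental_iff.1 hs _ h2
    have h4 := congrArg (Polynomial.eval 0) h3
    simp at h4
  · intro J x hJ hx hxJ
    obtain ⟨c, hc⟩ := exists_sub_mem_span_adjoin_singleton s x
    have hc0 : c ≠ 0 := by
      rintro rfl
      exact hx (by simpa using hc)
    have h1 : algebraMap κ (Algebra.adjoin κ {s}) c ∈ J := by
      simpa using sub_mem hxJ (hJ hc)
    have h2 := J.mul_mem_left (algebraMap κ (Algebra.adjoin κ {s}) c⁻¹) h1
    rwa [← map_mul, inv_mul_cancel₀ hc0, map_one] at h2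

theorem exists_zeros [IsAlgClosed κ] {s : K} (hs : Transcendental κ s)
    [FiniteDimensional κ⟮s⟯ K] [Algebra.IsSeparable κ⟮s⟯ K] :
    (∀ O : ValuationSubring K, IsPlace κ K O → O.valuation s < 1 →
      (∃ π, IsUniformizer K O π) ∧
        ∀ u, O.valuation u ≤ 1 → ∃ c : κ, O.valuation (u - algebraMap κ K c) < 1) ∧
    ∃ Z : {O : ValuationSubring K // IsPlace κ K O} →₀ ℤ,
      divDegree κ K Z = Module.finrank κ⟮s⟯ K ∧
      ∀ (O : {O : ValuationSubring K // IsPlace κ K O}) (π : K), IsUniformizer K O.1 π →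
        (O.1.valuation s < 1 → O.1.valuation s = O.1.valuation π ^ Z O) ∧
        (¬ O.1.valuation s < 1 → Z O = 0) := by
  let A := Algebra.adjoin κ {s}
  let B := integralClosure A K
  have : IsPrincipalIdealRing A := isPrincipalIdealRing_adjoin_singleton hs
  have : IsDedekindDomain B := integralClosure.isDedekindDomain A κ⟮s⟯ K
  have : IsFractionRing B K := integralClosure.isFractionRing_of_finite_extension κ⟮s⟯ K
  have : Module.Finite A B := IsIntegralClosure.finite A κ⟮s⟯ K B
  have hfr : Module.finrank A B = Module.finrank κ⟮s⟯ K :=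
    (IsFractionRing.finrank_eq A κ⟮s⟯ B K).symm
  have : Module.IsTorsionFree A B := inferInstance
  have hs0 : s ≠ 0 := by
    rintro rfl
    exact hs isAlgebraic_zero
  rw [← hfr]
  refine exists_zeros_of_isDedekindDomain (A := A) (B := B)
    (ϖ := ⟨s, Algebra.self_mem_adjoin_singleton κ s⟩)
    (fun h => hs0 (congrArg Subtype.val h)) (span_adjoin_singleton_isMaximal hs)
    (exists_sub_mem_span_adjoin_singleton s) ?_
  rintro O hO h ⟨a, ha : a ∈ Algebra.adjoin κ {s}⟩
  change a ∈ O
  obtain ⟨p, rfl⟩ := (AlgHom.mem_range _).1 (Algebra.adjoin_singleton_eq_range_aeval κ s ▸ ha)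
  have hsO : s ∈ O := (O.valuation_le_one_iff s).1 h.le
  rw [Polynomial.aeval_eq_sum_range]
  refine sum_mem fun i _ => ?_
  rw [Algebra.smul_def]
  exact mul_mem (hO.1 _) (pow_mem hsO i)

end ZeroDivisor

section SqrtTower

open Finset

variable {κ K : Type} [Field κ] [Field K] [Algebra (RatFunc κ) K]

/-- `K` is generated over `κ(t)` by square roots `z a` of `t - a`, for `a ∈ S`. -/
structure IsSqrtTower (S : Finset κ) (z : κ → K) : Prop where
  two_ne_zero : (2 : κ) ≠ 0
  sq : ∀ a ∈ S, z a ^ 2 = algebraMap (RatFunc κ) K (RatFunc.X - RatFunc.C a)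
  adjoin_eq_top : IntermediateField.adjoin (RatFunc κ) (z '' S) = ⊤

theorem ratFunc_X_sub_C_ne_zero (a : κ) : (RatFunc.X - RatFunc.C a : RatFunc κ) ≠ 0 := by
  rw [← RatFunc.algebraMap_X, ← RatFunc.algebraMap_C, ← map_sub]
  exact (map_ne_zero_iff _ (RatFunc.algebraMap_injective κ)).2 (Polynomial.X_sub_C_ne_zero a)

namespace IsSqrtTower

variable {S : Finset κ} {z : κ → K}

theorem ne_zero (h : IsSqrtTower S z) {a : κ} (ha : a ∈ S) : z a ≠ 0 := by
  intro h0
  have h1 := h.sq a ha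
  rw [h0, zero_pow (_root_.two_ne_zero), eq_comm, map_eq_zero] at h1
  exact ratFunc_X_sub_C_ne_zero a h1

theorem prod_ne_zero (h : IsSqrtTower S z) {T : Finset κ} (hT : T ⊆ S) : ∏ a ∈ T, z a ≠ 0 :=
  Finset.prod_ne_zero_iff.2 fun _ ha => h.ne_zero (hT ha)

theorem prod_sq (h : IsSqrtTower S z) {T : Finset κ} (hT : T ⊆ S) :
    (∏ a ∈ T, z a) ^ 2 = algebraMap (RatFunc κ) K
      (algebraMap (Polynomial κ) (RatFunc κ) (∏ a ∈ T, (Polynomial.X - Polynomial.C a))) := by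
  rw [← Finset.prod_pow, map_prod, map_prod]
  refine Finset.prod_congr rfl fun a ha => ?_
  rw [h.sq a (hT ha), map_sub (algebraMap (Polynomial κ) (RatFunc κ)), RatFunc.algebraMap_X,
    RatFunc.algebraMap_C]

theorem ratFunc_two_ne_zero (h : IsSqrtTower S z) : (2 : RatFunc κ) ≠ 0 := by
  intro h2
  refine h.two_ne_zero (RatFunc.C_injective ?_)
  rw [map_ofNat, h2, map_zero]

theorem span_prod_eq_top (h : IsSqrtTower S z) :
    Submodule.span (RatFunc κ) ((fun T : Finset κ => ∏ a ∈ T, z a) '' (S.powerset : Set (Finset κ)))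
      = ⊤ := by
  classical
  set M := Submodule.span (RatFunc κ)
    ((fun T : Finset κ => ∏ a ∈ T, z a) '' (S.powerset : Set (Finset κ))) with hM
  have hmem : ∀ T ⊆ S, ∏ a ∈ T, z a ∈ M := fun T hT =>
    Submodule.subset_span ⟨T, by simpa using hT, rfl⟩
  have hz : ∀ a ∈ S, ∀ m ∈ M, z a * m ∈ M := by
    intro a ha m hm
    induction hm using Submodule.span_induction with
    | zero => simp
    | add x y _ _ hx hy => rw [mul_add]; exact add_mem hx hy
    | smul c x _ hx => rw [mul_smul_comm]; exact M.smul_mem c hx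
    | mem x hx =>
      obtain ⟨T, hT, rfl⟩ := hx
      have hT : T ⊆ S := by simpa using hT
      by_cases haT : a ∈ T
      · have h1 : z a * ∏ b ∈ T, z b =
            (RatFunc.X - RatFunc.C a : RatFunc κ) • ∏ b ∈ T.erase a, z b := by
          rw [← Finset.mul_prod_erase T z haT, ← mul_assoc, ← pow_two, h.sq a ha, Algebra.smul_def]
        change z a * ∏ b ∈ T, z b ∈ M
        rw [h1]
        exact M.smul_mem _ (hmem _ ((Finset.erase_subset _ _).trans hT))
      · change z a * ∏ b ∈ T, z b ∈ M
        rw [← Finset.prod_insert haT]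
        exact hmem _ (Finset.insert_subset ha hT)
  have hadj : ∀ x ∈ Algebra.adjoin (RatFunc κ) (z '' S), ∀ m ∈ M, x * m ∈ M := by
    intro x hx
    induction hx using Algebra.adjoin_induction with
    | mem x hx =>
      obtain ⟨a, ha, rfl⟩ := hx
      exact hz a ha
    | algebraMap r =>
      intro m hm
      rw [← Algebra.smul_def]
      exact M.smul_mem r hm
    | add x y _ _ hx hy => intro m hm; rw [add_mul]; exact add_mem (hx m hm) (hy m hm)
    | mul x y _ _ hx hy => intro m hm; rw [mul_assoc]; exact hx _ (hy m hm)
  have halg : ∀ x ∈ z '' S, IsAlgebraic (RatFunc κ) x := by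
    rintro _ ⟨a, ha, rfl⟩
    refine (IsIntegral.of_pow two_pos ?_).isAlgebraic
    rw [h.sq a ha]
    exact isIntegral_algebraMap
  rw [eq_top_iff]
  intro x _
  have hx : x ∈ (IntermediateField.adjoin (RatFunc κ) (z '' S)).toSubalgebra := by
    rw [h.adjoin_eq_top]; trivial
  rw [IntermediateField.adjoin_toSubalgebra_of_isAlgebraic halg] at hx
  simpa using hadj x hx 1 (by simpa using hmem ∅ (Finset.empty_subset S))

theorem finiteDimensional (h : IsSqrtTower S z) : FiniteDimensional (RatFunc κ) K := by
  refine ⟨Submodule.fg_def.2 ⟨_, ?_, h.span_prod_eq_top⟩⟩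
  exact (Finset.finite_toSet _).image _

theorem isGalois (h : IsSqrtTower S z) : IsGalois (RatFunc κ) K := by
  classical
  have hfd := h.finiteDimensional
  let q : κ → Polynomial (RatFunc κ) := fun a =>
    Polynomial.X ^ 2 - Polynomial.C (RatFunc.X - RatFunc.C a)
  let p : Polynomial (RatFunc κ) := ∏ a ∈ S, q a
  have hq : ∀ a ∈ S, (q a).map (algebraMap (RatFunc κ) K) =
      (Polynomial.X - Polynomial.C (z a)) * (Polynomial.X - Polynomial.C (-z a)) := by
    intro a ha
    simp only [q, Polynomial.map_sub, Polynomial.map_pow, Polynomial.map_X, Polynomial.map_C,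
      ← h.sq a ha, Polynomial.C_neg, Polynomial.C_pow]
    ring
  have hq0 : ∀ a, q a ≠ 0 := fun a => Polynomial.X_pow_sub_C_ne_zero two_pos _
  have hp0 : p ≠ 0 := Finset.prod_ne_zero_iff.2 fun a _ => hq0 a
  have hsep : p.Separable := by
    refine Polynomial.separable_prod' (fun a _ b _ hab => ?_) fun a _ => ?_
    · have hab' : b - a ≠ 0 := sub_ne_zero.2 hab.symm
      have hu : IsUnit (Polynomial.C (RatFunc.C (b - a)) : Polynomial (RatFunc κ)) :=
        Polynomial.isUnit_C.2 (IsUnit.mk0 _ ((map_ne_zero _).2 hab'))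
      have h1 : q b = q a + Polynomial.C (RatFunc.C (b - a)) := by
        simp only [q, map_sub]; ring
      rw [h1]
      have h2 : IsCoprime (q a) (Polynomial.C (RatFunc.C (b - a)) + q a * 1) :=
        IsCoprime.add_mul_left_right (isCoprime_one_right.of_isCoprime_of_dvd_right hu.dvd) 1
      rwa [mul_one, add_comm] at h2
    · exact Polynomial.separable_X_pow_sub_C _ (by exact_mod_cast h.ratFunc_two_ne_zero)
        (ratFunc_X_sub_C_ne_zero a)
  have hroot : ∀ a ∈ S, z a ∈ p.rootSet K := by
    intro a ha
    rw [Polynomial.mem_rootSet]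
    refine ⟨hp0, ?_⟩
    rw [map_prod]
    refine Finset.prod_eq_zero ha ?_
    simp [q, h.sq a ha]
  have : p.IsSplittingField (RatFunc κ) K := by
    constructor
    · rw [Polynomial.map_prod]
      refine Polynomial.Splits.prod fun a ha => ?_
      rw [hq a ha]
      exact (Polynomial.Splits.X_sub_C _).mul (Polynomial.Splits.X_sub_C _)
    · have halg : ∀ x ∈ (p.rootSet K : Set K), IsAlgebraic (RatFunc κ) x :=
        fun x _ => Algebra.IsAlgebraic.isAlgebraic x
      rw [← IntermediateField.adjoin_toSubalgebra_of_isAlgebraic halg]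
      have : IntermediateField.adjoin (RatFunc κ) (p.rootSet K) = ⊤ := by
        rw [eq_top_iff, ← h.adjoin_eq_top]
        refine IntermediateField.adjoin.mono _ _ _ ?_
        rintro _ ⟨a, ha, rfl⟩
        exact hroot a ha
      rw [this, IntermediateField.top_toSubalgebra]
  exact IsGalois.of_separable_splitting_field hsep

theorem prod_mul_prod_notMem_range (h : IsSqrtTower S z) {T T' : Finset κ} (hT : T ⊆ S)
    (hT' : T' ⊆ S) {a : κ} (ha : a ∈ T) (ha' : a ∉ T') :
    (∏ b ∈ T, z b) * ∏ b ∈ T', z b ∉ Set.range (algebraMap (RatFunc κ) K) := by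
  classical
  rintro ⟨r, hr⟩
  let d : Finset κ → Polynomial κ := fun T => ∏ a ∈ T, (Polynomial.X - Polynomial.C a)
  have hr2 : r ^ 2 = algebraMap (Polynomial κ) (RatFunc κ) (d T * d T') := by
    apply (algebraMap (RatFunc κ) K).injective
    rw [map_pow, hr, mul_pow, h.prod_sq hT, h.prod_sq hT', map_mul, map_mul]
  obtain ⟨p, rfl⟩ := IsIntegrallyClosed.isIntegral_iff.1
    (IsIntegral.of_pow (R := Polynomial κ) two_pos (hr2 ▸ isIntegral_algebraMap) : IsIntegral _ r)
  rw [← map_pow] at hr2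
  have hp : p ^ 2 = d T * d T' := RatFunc.algebraMap_injective κ hr2
  have hd : d T = (Polynomial.X - Polynomial.C a) * d (T.erase a) :=
    (Finset.mul_prod_erase T _ ha).symm
  have hroot : p.eval a = 0 := by
    have := congrArg (Polynomial.eval a) hp
    rw [hd] at this
    simpa using this
  obtain ⟨s, rfl⟩ := Polynomial.dvd_iff_isRoot.2 hroot
  rw [hd, mul_pow, pow_two (Polynomial.X - Polynomial.C a), mul_assoc, mul_assoc] at hp
  have h1 := congrArg (Polynomial.eval a) (mul_left_cancel₀ (Polynomial.X_sub_C_ne_zero a) hp)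
  simp only [Polynomial.eval_mul, Polynomial.eval_sub, Polynomial.eval_X, Polynomial.eval_C,
    sub_self, zero_mul, d, Polynomial.eval_prod] at h1
  rw [eq_comm, mul_eq_zero, Finset.prod_eq_zero_iff, Finset.prod_eq_zero_iff] at h1
  rcases h1 with ⟨b, hb, h1⟩ | ⟨b, hb, h1⟩
  · exact (Finset.mem_erase.1 hb).1 (sub_eq_zero.1 h1).symm
  · exact ha' ((sub_eq_zero.1 h1) ▸ hb)

theorem aut_prod (h : IsSqrtTower S z) (σ : K ≃ₐ[RatFunc κ] K) {T : Finset κ} (hT : T ⊆ S) :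
    σ (∏ a ∈ T, z a) = ∏ a ∈ T, z a ∨ σ (∏ a ∈ T, z a) = -∏ a ∈ T, z a := by
  rw [← sq_eq_sq_iff_eq_or_eq_neg, ← map_pow, h.prod_sq hT, AlgEquiv.commutes]

theorem exists_aut_separating (h : IsSqrtTower S z) {T T' : Finset κ} (hT : T ⊆ S) (hT' : T' ⊆ S)
    (hne : T ≠ T') : ∃ σ : K ≃ₐ[RatFunc κ] K,
      σ ((∏ a ∈ T, z a) * ∏ a ∈ T', z a) = -((∏ a ∈ T, z a) * ∏ a ∈ T', z a) := by
  have hfd := h.finiteDimensional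
  have hgal := h.isGalois
  have hnot : (∏ b ∈ T, z b) * ∏ b ∈ T', z b ∉ Set.range (algebraMap (RatFunc κ) K) := by
    by_cases hsub : T ⊆ T'
    · obtain ⟨a, ha, ha'⟩ := Finset.exists_of_ssubset (hsub.ssubset_of_ne hne)
      rw [mul_comm]
      exact h.prod_mul_prod_notMem_range hT' hT ha ha'
    · obtain ⟨a, ha, ha'⟩ := Finset.not_subset.1 hsub
      exact h.prod_mul_prod_notMem_range hT hT' ha ha'
  rw [IsGalois.mem_range_algebraMap_iff_fixed] at hnot
  push Not at hnot
  obtain ⟨σ, hσ⟩ := hnot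
  refine ⟨σ, ?_⟩
  rw [map_mul] at hσ ⊢
  rcases h.aut_prod σ hT with h1 | h1 <;> rcases h.aut_prod σ hT' with h2 | h2 <;>
    rw [h1, h2] at hσ ⊢ <;> simp at hσ ⊢

/-- A subspace stable under all automorphisms contains the components of its elements along the
basis of products of the `z a`. -/
theorem component_mem (h : IsSqrtTower S z) (V : AddSubgroup K)
    (hσ : ∀ (σ : K ≃ₐ[RatFunc κ] K), ∀ f ∈ V, σ f ∈ V)
    (h2 : ∀ f, 2 * f ∈ V → f ∈ V)
    (U : Finset (Finset κ)) (hU : ∀ T ∈ U, T ⊆ S) (f : Finset κ → RatFunc κ) {T₀ : Finset κ}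
    (hT₀ : T₀ ∈ U) (hf : ∑ T ∈ U, f T • ∏ a ∈ T, z a ∈ V) : f T₀ • ∏ a ∈ T₀, z a ∈ V := by
  classical
  suffices H : ∀ (U : Finset (Finset κ)), (∀ T ∈ U, T ⊆ S) → T₀ ∉ U → T₀ ⊆ S →
      ∀ f : Finset κ → RatFunc κ, f T₀ • ∏ a ∈ T₀, z a + ∑ T ∈ U, f T • ∏ a ∈ T, z a ∈ V →
      f T₀ • ∏ a ∈ T₀, z a ∈ V by
    rw [← Finset.add_sum_erase U _ hT₀] at hf
    exact H (U.erase T₀) (fun T hT => hU T (Finset.mem_of_mem_erase hT))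
      (Finset.notMem_erase T₀ U) (hU T₀ hT₀) f hf
  clear hf hT₀ hU f U
  intro U
  induction U using Finset.induction_on with
  | empty => intro _ _ _ f hf; simpa using hf
  | insert T₁ U hT₁ ih =>
    intro hU h0 hS f hf
    have hU' : ∀ T ∈ U, T ⊆ S := fun T hT => hU T (Finset.mem_insert_of_mem hT)
    have hS₁ : T₁ ⊆ S := hU T₁ (Finset.mem_insert_self _ _)
    have hne : T₀ ≠ T₁ := fun h => h0 (h ▸ Finset.mem_insert_self _ _)
    obtain ⟨σ, hσ'⟩ := h.exists_aut_separating hS hS₁ hne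
    obtain ⟨ε, hε, hεσ⟩ : ∃ ε : ℤ, (ε = 1 ∨ ε = -1) ∧
        σ (∏ a ∈ T₀, z a) = ε • ∏ a ∈ T₀, z a := by
      rcases h.aut_prod σ hS with h1 | h1
      exacts [⟨1, by simp, by simpa using h1⟩, ⟨-1, by simp, by simpa using h1⟩]
    have hεε : ε * ε = 1 := by rcases hε with rfl | rfl <;> rfl
    choose! η hη using fun T (hT : T ⊆ S) => show ∃ η : RatFunc κ,
        σ (∏ a ∈ T, z a) = η • ∏ a ∈ T, z a by
      rcases h.aut_prod σ hT with h1 | h1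
      exacts [⟨1, by simpa using h1⟩, ⟨-1, by simpa using h1⟩]
    have hη0 : η T₀ = ε := by
      have h1 := hη T₀ hS
      rw [hεσ, zsmul_eq_mul, Algebra.smul_def] at h1
      have h2 := mul_right_cancel₀ (h.prod_ne_zero hS) h1
      apply (algebraMap (RatFunc κ) K).injective
      rw [← h2, map_intCast]
    have hη1 : η T₁ = -ε := by
      rw [map_mul, hη T₀ hS, hη T₁ hS₁, smul_mul_smul_comm, Algebra.smul_def, ← neg_one_mul] at hσ'
      have h2 := mul_right_cancel₀
        (mul_ne_zero (h.prod_ne_zero hS) (h.prod_ne_zero hS₁)) hσ'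
      have h3 : η T₀ * η T₁ = -1 := by
        apply (algebraMap (RatFunc κ) K).injective
        rw [h2, map_neg, map_one]
      have h4 : (ε : RatFunc κ) * ε = 1 := by exact_mod_cast congrArg (Int.cast (R := RatFunc κ)) hεε
      rw [hη0] at h3
      linear_combination (ε : RatFunc κ) * h3 - η T₁ * h4
    let g : Finset κ → RatFunc κ := fun T => (1 + ε * η T) * f T
    have h4 : (ε : RatFunc κ) * ε = 1 := by exact_mod_cast congrArg (Int.cast (R := RatFunc κ)) hεε
    have hg0 : g T₀ = 2 * f T₀ := by
      simp only [g, hη0]; rw [h4]; ring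
    have hg1 : g T₁ = 0 := by
      simp only [g, hη1]; rw [mul_neg, h4]; ring
    have key := ih hU' (fun h => h0 (Finset.mem_insert_of_mem h)) hS g (by
      have hmem := add_mem hf (AddSubgroup.zsmul_mem V (hσ σ _ hf) ε)
      convert hmem using 1
      have hterm : ∀ T ⊆ S, g T • ∏ a ∈ T, z a =
          f T • ∏ a ∈ T, z a + ε • σ (f T • ∏ a ∈ T, z a) := by
        intro T hT
        rw [map_smul, hη T hT, smul_smul, ← Int.cast_smul_eq_zsmul (RatFunc κ), smul_smul,
          ← add_smul]
        congr 1
        simp only [g]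
        ring
      rw [Finset.sum_insert hT₁, map_add, map_add, map_sum, smul_add, smul_add, Finset.smul_sum,
        hterm T₀ hS, Finset.sum_congr rfl fun T hT => hterm T (hU' T hT), Finset.sum_add_distrib]
      have h1 := hterm T₁ hS₁
      rw [hg1, zero_smul] at h1
      linear_combination h1)
    rw [hg0, mul_smul, Algebra.smul_def, map_ofNat] at key
    exact h2 _ key

theorem linearIndepOn_prod (h : IsSqrtTower S z) :
    LinearIndepOn (RatFunc κ) (fun T : Finset κ => ∏ a ∈ T, z a)
      (S.powerset : Set (Finset κ)) := by
  have h2 : (2 : K) ≠ 0 := by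
    rw [← map_ofNat (algebraMap (RatFunc κ) K)]
    exact (map_ne_zero _).2 h.ratFunc_two_ne_zero
  rw [linearIndepOn_finset_iff]
  intro f hf T hT
  have hT' := Finset.mem_powerset.1 hT
  have := h.component_mem ⊥ (fun σ f hf => by simp_all)
    (fun f hf => by
      rw [AddSubgroup.mem_bot, mul_eq_zero] at hf
      exact hf.resolve_left h2)
    S.powerset (fun T hT => Finset.mem_powerset.1 hT) f hT hf
  exact (smul_eq_zero.1 (AddSubgroup.mem_bot.1 this)).resolve_right (h.prod_ne_zero hT')

theorem finrank_eq (h : IsSqrtTower S z) : Module.finrank (RatFunc κ) K = 2 ^ S.card := by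
  have hfd := h.finiteDimensional
  have hli := h.linearIndepOn_prod
  have hsp := h.span_prod_eq_top
  rw [Set.image_eq_range] at hsp
  rw [Module.finrank_eq_card_basis (Module.Basis.mk hli hsp.ge)]
  simp

theorem exists_eq_sum (h : IsSqrtTower S z) (x : K) :
    ∃ f : Finset κ → RatFunc κ, x = ∑ T ∈ S.powerset, f T • ∏ a ∈ T, z a := by
  classical
  have hx : x ∈ Submodule.span (RatFunc κ)
      ((fun T : Finset κ => ∏ a ∈ T, z a) '' (S.powerset : Set (Finset κ))) := by
    rw [h.span_prod_eq_top]; trivial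
  obtain ⟨f, hf⟩ := (Submodule.mem_span_image_finset_iff_exists_fun _).1 hx
  refine ⟨fun T => if hT : T ∈ S.powerset then f ⟨T, hT⟩ else 0, ?_⟩
  rw [← hf, ← Finset.sum_attach S.powerset, Finset.univ_eq_attach]
  refine Finset.sum_congr rfl fun T _ => ?_
  simp only [dif_pos T.2]

end IsSqrtTower

end SqrtTower

section TowerPlaces

open IntermediateField

variable {κ K : Type} [Field κ] [Field K] [Algebra κ K] [Algebra (RatFunc κ) K]
  [IsScalarTower κ (RatFunc κ) K] {S : Finset κ} {z : κ → K}

local notation "Pl" => {O : ValuationSubring K // IsPlace κ K O}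
local notation "t" => algebraMap (RatFunc κ) K RatFunc.X

theorem transcendental_of_adjoin_simple_eq_top {u : RatFunc κ} (hu : κ⟮u⟯ = ⊤) :
    Transcendental κ u := by
  intro halg
  have := isAlgebraic_adjoin_simple halg.isIntegral
  have hX : (RatFunc.X : RatFunc κ) ∈ κ⟮u⟯ := hu ▸ trivial
  have h1 : IsAlgebraic κ (⟨RatFunc.X, hX⟩ : κ⟮u⟯) := Algebra.IsAlgebraic.isAlgebraic _
  exact RatFunc.transcendental_X (h1.algHom κ⟮u⟯.val)

variable (κ) in
theorem adjoin_X_sub_C_eq_top (c : κ) : κ⟮(RatFunc.X - RatFunc.C c : RatFunc κ)⟯ = ⊤ := by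
  rw [eq_top_iff, ← RatFunc.adjoin_X, adjoin_simple_le_iff]
  have h1 := mem_adjoin_simple_self κ (RatFunc.X - RatFunc.C c : RatFunc κ)
  simpa [← RatFunc.algebraMap_eq_C] using
    add_mem h1 (_root_.algebraMap_mem κ⟮(RatFunc.X - RatFunc.C c : RatFunc κ)⟯ c)

variable (κ) in
theorem adjoin_inv_X_eq_top : κ⟮(RatFunc.X⁻¹ : RatFunc κ)⟯ = ⊤ := by
  rw [eq_top_iff, ← RatFunc.adjoin_X, adjoin_simple_le_iff]
  simpa using inv_mem (mem_adjoin_simple_self κ (RatFunc.X⁻¹ : RatFunc κ))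

theorem algebraMap_X_sub_C (c : κ) :
    t - algebraMap κ K c = algebraMap (RatFunc κ) K (RatFunc.X - RatFunc.C c) := by
  rw [map_sub, IsScalarTower.algebraMap_apply κ (RatFunc κ) K, RatFunc.algebraMap_eq_C]

theorem IsUniformizer.pos_of_zpow_lt_one {O : ValuationSubring K} (hO : O.toSubring ≠ ⊤)
    {π : K} (hπ : IsUniformizer K O π) {k : ℤ} (hk : O.valuation π ^ k < 1) : 0 < k := by
  by_contra! hk'
  have h0 : 0 < O.valuation π := (Valuation.pos_iff _).2 (hπ.ne_zero hO)
  exact absurd hk (not_lt.2 (one_le_zpow_of_nonpos₀ h0 (isUniformizer_iff.1 hπ).1.le hk'))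

namespace IsSqrtTower

theorem exists_zeros_of_adjoin_simple_eq_top [IsAlgClosed κ] (h : IsSqrtTower S z) {u : RatFunc κ}
    (hu : κ⟮u⟯ = ⊤) {s : K} (hsu : s = algebraMap (RatFunc κ) K u) :
    (∀ O : ValuationSubring K, IsPlace κ K O → O.valuation s < 1 →
      (∃ π, IsUniformizer K O π) ∧
        ∀ u, O.valuation u ≤ 1 → ∃ c : κ, O.valuation (u - algebraMap κ K c) < 1) ∧
    ∃ Z : Pl →₀ ℤ, divDegree κ K Z = 2 ^ S.card ∧
      ∀ (O : Pl) (π : K), IsUniformizer K O.1 π →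
        (O.1.valuation s < 1 → O.1.valuation s = O.1.valuation π ^ Z O) ∧
        (¬ O.1.valuation s < 1 → Z O = 0) := by
  subst hsu
  have hfd := h.finiteDimensional
  have hgal := h.isGalois
  have htr : Transcendental κ (algebraMap (RatFunc κ) K u) :=
    (transcendental_algebraMap_iff (algebraMap (RatFunc κ) K).injective).2
      (transcendental_of_adjoin_simple_eq_top hu)
  have hmap : ∀ x, x ∈ κ⟮algebraMap (RatFunc κ) K u⟯ ↔ ∃ y, algebraMap (RatFunc κ) K y = x := by
    have h1 := adjoin_map κ {u} (IsScalarTower.toAlgHom κ (RatFunc κ) K)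
    rw [hu, Set.image_singleton, IsScalarTower.coe_toAlgHom'] at h1
    intro x
    rw [← h1]
    simp [IntermediateField.mem_map]
  let e : RatFunc κ ≃+* κ⟮algebraMap (RatFunc κ) K u⟯ := RingEquiv.ofBijective
    ((algebraMap (RatFunc κ) K).codRestrict _ fun x => (hmap _).2 ⟨x, rfl⟩)
    ⟨fun x y hxy => (algebraMap (RatFunc κ) K).injective (congrArg Subtype.val hxy),
      fun ⟨x, hx⟩ => by
        obtain ⟨y, rfl⟩ := (hmap x).1 hx
        exact ⟨y, rfl⟩⟩
  have hcomp : (algebraMap κ⟮algebraMap (RatFunc κ) K u⟯ K).comp (e : RatFunc κ →+* _) =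
      (RingEquiv.refl K : K →+* K).comp (algebraMap (RatFunc κ) K) := rfl
  have hfr : Module.finrank κ⟮algebraMap (RatFunc κ) K u⟯ K = 2 ^ S.card := by
    rw [← h.finrank_eq]
    exact (Algebra.finrank_eq_of_equiv_equiv e (RingEquiv.refl K) hcomp).symm
  have : FiniteDimensional κ⟮algebraMap (RatFunc κ) K u⟯ K :=
    FiniteDimensional.of_finrank_pos (by rw [hfr]; positivity)
  have : Algebra.IsSeparable κ⟮algebraMap (RatFunc κ) K u⟯ K :=
    Algebra.IsSeparable.of_equiv_equiv e (RingEquiv.refl K) hcomp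
  have := exists_zeros htr
  rw [hfr] at this
  exact_mod_cast this

theorem exists_valuation_sub_lt_one [IsAlgClosed κ] (h : IsSqrtTower S z) {O : ValuationSubring K}
    (hO : IsPlace κ K O) (ht : O.valuation t ≤ 1) :
    ∃ c : κ, O.valuation (t - algebraMap κ K c) < 1 := by
  by_contra! hc
  have hfd := h.finiteDimensional
  have hc1 : ∀ c, O.valuation (t - algebraMap κ K c) = 1 := fun c =>
    le_antisymm (Valuation.map_sub_le _ ht (hO.valuation_algebraMap_le_one c)) (hc c)
  have hpoly : ∀ p : Polynomial κ, p ≠ 0 →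
      O.valuation (algebraMap (RatFunc κ) K (algebraMap (Polynomial κ) (RatFunc κ) p)) = 1 := by
    intro p hp
    have hval : ∀ a : κ, O.valuation (algebraMap (RatFunc κ) K
        (algebraMap (Polynomial κ) (RatFunc κ) (Polynomial.X - Polynomial.C a))) = 1 := by
      intro a
      rw [map_sub (algebraMap (Polynomial κ) (RatFunc κ)), RatFunc.algebraMap_X,
        RatFunc.algebraMap_C, ← algebraMap_X_sub_C, hc1]
    rw [(IsAlgClosed.splits p).eq_prod_roots]
    simp only [map_mul, RatFunc.algebraMap_C, ← RatFunc.algebraMap_eq_C,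
      ← IsScalarTower.algebraMap_apply]
    rw [hO.valuation_algebraMap (by simpa using hp), one_mul, map_multiset_prod,
      map_multiset_prod, map_multiset_prod]
    refine Multiset.prod_eq_one fun x hx => ?_
    simp only [Multiset.map_map, Multiset.mem_map, Function.comp_apply] at hx
    obtain ⟨a, -, rfl⟩ := hx
    exact hval a
  have hF : ∀ r : RatFunc κ, algebraMap (RatFunc κ) K r ∈ O := by
    intro r
    rw [← O.valuation_le_one_iff, ← RatFunc.num_div_denom r, map_div₀, map_div₀,
      hpoly _ (RatFunc.denom_ne_zero r), div_one]
    by_cases h0 : r.num = 0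
    · simp [h0]
    · exact (hpoly _ h0).le
  exact hO.2 (top_unique fun x _ =>
    O.mem_of_isIntegral' hF (Algebra.IsIntegral.isIntegral (R := RatFunc κ) x))

theorem placesRational [IsAlgClosed κ] (h : IsSqrtTower S z) : PlacesRational κ K := by
  intro O
  by_cases ht : O.1.valuation t ≤ 1
  · obtain ⟨c, hc⟩ := h.exists_valuation_sub_lt_one O.2 ht
    exact (h.exists_zeros_of_adjoin_simple_eq_top (adjoin_X_sub_C_eq_top κ c)
      (algebraMap_X_sub_C c)).1 O.1 O.2 hc
  · refine (h.exists_zeros_of_adjoin_simple_eq_top (adjoin_inv_X_eq_top κ) rfl).1 O.1 O.2 ?_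
    rw [map_inv₀, map_inv₀]
    exact inv_lt_one_of_one_lt₀ (not_le.1 ht)

/-- The divisor of zeros of `t - c`. -/
theorem exists_zeros_sub [IsAlgClosed κ] (h : IsSqrtTower S z) (c : κ) :
    ∃ Z : Pl →₀ ℤ, divDegree κ K Z = 2 ^ S.card ∧ ∀ (O : Pl),
      (O.1.valuation (t - algebraMap κ K c) < 1 → 0 < Z O) ∧
      (¬ O.1.valuation (t - algebraMap κ K c) < 1 → Z O = 0) ∧
      ∀ π, IsUniformizer K O.1 π → O.1.valuation (t - algebraMap κ K c) < 1 →
        O.1.valuation (t - algebraMap κ K c) = O.1.valuation π ^ Z O := by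
  obtain ⟨Z, hdeg, hZ⟩ := (h.exists_zeros_of_adjoin_simple_eq_top (adjoin_X_sub_C_eq_top κ c)
      (algebraMap_X_sub_C c)).2
  refine ⟨Z, hdeg, fun O => ?_⟩
  obtain ⟨π, hπ⟩ := (h.placesRational O).1
  refine ⟨fun hlt => ?_, (hZ O π hπ).2, fun π hπ => (hZ O π hπ).1⟩
  exact hπ.pos_of_zpow_lt_one O.2.2 ((hZ O π hπ).1 hlt ▸ hlt)

/-- The divisor of poles of `t`. -/
theorem exists_poles [IsAlgClosed κ] (h : IsSqrtTower S z) :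
    ∃ Z : Pl →₀ ℤ, divDegree κ K Z = 2 ^ S.card ∧ ∀ (O : Pl),
      (1 < O.1.valuation t → 0 < Z O) ∧ (O.1.valuation t ≤ 1 → Z O = 0) ∧
      ∀ π, IsUniformizer K O.1 π → 1 < O.1.valuation t →
        O.1.valuation t = O.1.valuation π ^ (-Z O) := by
  obtain ⟨Z, hdeg, hZ⟩ := (h.exists_zeros_of_adjoin_simple_eq_top (adjoin_inv_X_eq_top κ) rfl).2
  have hlt : ∀ O : Pl, O.1.valuation (algebraMap (RatFunc κ) K RatFunc.X⁻¹) < 1 ↔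
      1 < O.1.valuation t := by
    intro O
    rw [map_inv₀, map_inv₀, inv_lt_one₀]
    exact (Valuation.pos_iff _).2 ((map_ne_zero _).2 RatFunc.X_ne_zero)
  refine ⟨Z, hdeg, fun O => ?_⟩
  obtain ⟨π, hπ⟩ := (h.placesRational O).1
  refine ⟨fun h1 => ?_, fun h1 => (hZ O π hπ).2 (mt (hlt O).1 (not_lt.2 h1)), fun π hπ h1 => ?_⟩
  · have h2 := (hlt O).2 h1
    exact hπ.pos_of_zpow_lt_one O.2.2 ((hZ O π hπ).1 h2 ▸ h2)
  · rw [zpow_neg, ← (hZ O π hπ).1 ((hlt O).2 h1), map_inv₀, map_inv₀, inv_inv]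

theorem exists_place_valuation_sub_lt_one [IsAlgClosed κ] (h : IsSqrtTower S z) (c : κ) :
    ∃ O : Pl, O.1.valuation (t - algebraMap κ K c) < 1 := by
  obtain ⟨Z, hdeg, hZ⟩ := h.exists_zeros_sub c
  by_contra! hc
  have : Z = 0 := Finsupp.ext fun O => (hZ O).2.1 (not_lt.2 (hc O))
  rw [this, divDegree, Finsupp.sum_zero_index] at hdeg
  exact (pow_pos two_pos S.card : (0 : ℤ) < 2 ^ S.card).ne hdeg

theorem exists_place_one_lt_valuation [IsAlgClosed κ] (h : IsSqrtTower S z) :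
    ∃ O : Pl, 1 < O.1.valuation t := by
  obtain ⟨Z, hdeg, hZ⟩ := h.exists_poles
  by_contra! hc
  have : Z = 0 := Finsupp.ext fun O => (hZ O).2.1 (hc O)
  rw [this, divDegree, Finsupp.sum_zero_index] at hdeg
  exact (pow_pos two_pos S.card : (0 : ℤ) < 2 ^ S.card).ne hdeg

end IsSqrtTower

end TowerPlaces

section PolynomialValues

variable {κ K : Type} [Field κ] [Field K] [Algebra κ K]

local notation "Pl" => {O : ValuationSubring K // IsPlace κ K O}

theorem mem_RRspace_smul_poles (hPR : PlacesRational κ K) {s : K} {P : Pl →₀ ℤ}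
    (hP : ∀ (O : Pl), (O.1.valuation s ≤ 1 → P O = 0) ∧
      ∀ π, IsUniformizer K O.1 π → 1 < O.1.valuation s →
        O.1.valuation s = O.1.valuation π ^ (-P O)) (m : ℕ) {f : K} :
    f ∈ RRspace κ K ((m : ℤ) • P) ↔ ∀ O : Pl, (O.1.valuation s ≤ 1 → O.1.valuation f ≤ 1) ∧
      (1 < O.1.valuation s → O.1.valuation f ≤ O.1.valuation s ^ m) := by
  rw [mem_RRspace_iff]
  refine forall_congr' fun O => ?_
  have key : ∀ π, IsUniformizer K O.1 π → 1 < O.1.valuation s →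
      (O.1.valuation π ^ (((m : ℤ) • P) O) * O.1.valuation f ≤ 1 ↔
        O.1.valuation f ≤ O.1.valuation s ^ m) := by
    intro π hπ h1
    have h0 : 0 < O.1.valuation π := (Valuation.pos_iff _).2 (hπ.ne_zero O.2.2)
    rw [← le_inv_mul_iff₀ (zpow_pos h0 _), mul_one, (hP O).2 π hπ h1, ← zpow_natCast, ← zpow_mul,
      ← zpow_neg, Finsupp.smul_apply, smul_eq_mul, neg_mul, mul_comm (P O)]
  obtain ⟨π, hπ⟩ := (hPR O).1
  by_cases h1 : 1 < O.1.valuation s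
  · refine ⟨fun h => ⟨fun h2 => absurd h1 (not_lt.2 h2), fun _ => (key π hπ h1).1 (h π hπ)⟩,
      fun h π hπ => (key π hπ h1).2 (h.2 h1)⟩
  · have h0 := (hP O).1 (not_lt.1 h1)
    simp only [Finsupp.smul_apply, h0, smul_zero, zpow_zero, one_mul]
    exact ⟨fun h => ⟨fun _ => h π hπ, fun h2 => absurd h2 h1⟩, fun h _ _ => h.1 (not_lt.1 h1)⟩

theorem IsPlace.valuation_aeval_le_one {O : ValuationSubring K} (hO : IsPlace κ K O) {s : K}
    (hs : O.valuation s ≤ 1) (p : Polynomial κ) : O.valuation (Polynomial.aeval s p) ≤ 1 := by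
  rw [ValuationSubring.valuation_le_one_iff] at hs ⊢
  rw [Polynomial.aeval_eq_sum_range]
  refine sum_mem fun i _ => ?_
  rw [Algebra.smul_def]
  exact mul_mem (hO.1 _) (pow_mem hs i)

theorem IsPlace.valuation_aeval_of_one_lt {O : ValuationSubring K} (hO : IsPlace κ K O) {s : K}
    (hs : 1 < O.valuation s) {p : Polynomial κ} (hp : p ≠ 0) :
    O.valuation (Polynomial.aeval s p) = O.valuation s ^ p.natDegree := by
  have : O.valuation.IsTrivialOn κ := ⟨fun a ha => hO.valuation_algebraMap ha⟩
  exact Polynomial.valuation_aeval_eq_valuation_X_pow_natDegree_of_one_lt_valuation_X s hs hp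

/-- A polynomial not vanishing at `c` is a unit at every place above `c`. -/
theorem IsPlace.valuation_aeval_eq_one {O : ValuationSubring K} (hO : IsPlace κ K O) {s : K} {c : κ}
    (hs : O.valuation (s - algebraMap κ K c) < 1) {p : Polynomial κ} (hp : p.eval c ≠ 0) :
    O.valuation (Polynomial.aeval s p) = 1 := by
  have hs1 : O.valuation s ≤ 1 := by
    have := O.valuation.map_add (s - algebraMap κ K c) (algebraMap κ K c)
    rw [sub_add_cancel] at this
    exact this.trans (max_le hs.le (hO.valuation_algebraMap_le_one c))
  obtain ⟨q, hq⟩ := Polynomial.X_sub_C_dvd_sub_C_eval (p := p) (a := c)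
  have h1 : Polynomial.aeval s p =
      algebraMap κ K (p.eval c) + (s - algebraMap κ K c) * Polynomial.aeval s q := by
    have := congrArg (Polynomial.aeval s) hq
    simp only [map_sub, map_mul, Polynomial.aeval_X, Polynomial.aeval_C] at this
    linear_combination this
  have h2 : O.valuation ((s - algebraMap κ K c) * Polynomial.aeval s q) < 1 := by
    rw [map_mul]
    exact mul_lt_one_of_lt_of_le hs (hO.valuation_aeval_le_one hs1 q)
  have h3 := hO.valuation_algebraMap hp
  rw [h1, Valuation.map_add_eq_of_lt_left _ (by rwa [h3]), h3]

end PolynomialValues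

section TowerRiemannRoch

open Polynomial

variable {κ K : Type} [Field κ] [Field K] [Algebra κ K] [Algebra (RatFunc κ) K]
  [IsScalarTower κ (RatFunc κ) K] {S : Finset κ} {z : κ → K}

local notation "Pl" => {O : ValuationSubring K // IsPlace κ K O}
local notation "t" => algebraMap (RatFunc κ) K RatFunc.X

theorem algebraMap_algebraMap_eq_aeval (p : κ[X]) :
    algebraMap (RatFunc κ) K (algebraMap κ[X] (RatFunc κ) p) = aeval t p := by
  rw [aeval_algebraMap_apply, ← RatFunc.algebraMap_X, aeval_algebraMap_apply, aeval_X_left_apply]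

theorem natDegree_prod_X_sub_C (T : Finset κ) : (∏ a ∈ T, (X - C a)).natDegree = T.card := by
  rw [natDegree_prod_of_monic _ _ fun a _ => monic_X_sub_C a]
  simp

theorem natDegree_sq_mul_prod {p : κ[X]} (hp : p ≠ 0) (T : Finset κ) :
    (p ^ 2 * ∏ a ∈ T, (X - C a)).natDegree = 2 * p.natDegree + T.card := by
  rw [natDegree_mul (pow_ne_zero 2 hp) (Finset.prod_ne_zero_iff.2 fun a _ => X_sub_C_ne_zero a),
    natDegree_pow, natDegree_prod_X_sub_C]

/-- The pullback of a place along a `κ(t)`-automorphism. -/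
theorem IsPlace.comap {O : ValuationSubring K} (hO : IsPlace κ K O) (σ : K ≃ₐ[RatFunc κ] K) :
    IsPlace κ K (O.comap (σ : K →+* K)) := by
  refine ⟨fun c => ?_, fun h => hO.2 (top_unique fun x _ => ?_)⟩
  · rw [ValuationSubring.mem_comap, IsScalarTower.algebraMap_apply κ (RatFunc κ) K]
    change σ _ ∈ O
    rw [σ.commutes, ← IsScalarTower.algebraMap_apply]
    exact hO.1 c
  · have h1 : σ.symm x ∈ (O.comap (σ : K →+* K)).toSubring := h ▸ trivial
    have h2 : σ (σ.symm x) ∈ O := h1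
    rwa [σ.apply_symm_apply] at h2

namespace IsSqrtTower

/-- The component of index `T` of an element regular away from the poles of `t`
is a polynomial multiple of `∏ a ∈ T, z a`. -/
theorem exists_aeval_eq_of_regular [IsAlgClosed κ] (h : IsSqrtTower S z) {T : Finset κ}
    (hT : T ⊆ S) {r : RatFunc κ}
    (hr : ∀ O : Pl, O.1.valuation t ≤ 1 → O.1.valuation (r • ∏ a ∈ T, z a) ≤ 1) :
    ∃ p : κ[X], r = algebraMap κ[X] (RatFunc κ) p := by
  classical
  suffices hd : r.denom.degree = 0 by
    have h1 : r.denom = 1 := eq_one_of_monic_natDegree_zero (RatFunc.monic_denom r)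
      (natDegree_eq_zero_iff_degree_le_zero.2 hd.le)
    refine ⟨r.num, ?_⟩
    conv_lhs => rw [← RatFunc.num_div_denom r, h1, map_one, div_one]
  by_contra hd
  obtain ⟨c, hc⟩ := IsAlgClosed.exists_root r.denom hd
  obtain ⟨O, hO⟩ := h.exists_place_valuation_sub_lt_one c
  have hnum : r.num.eval c ≠ 0 := fun h0 =>
    (RatFunc.isCoprime_num_denom r).isUnit_of_dvd' (dvd_iff_isRoot.2 h0) (dvd_iff_isRoot.2 hc) |>
      fun hu => not_isUnit_X_sub_C c hu
  have hs1 : O.1.valuation t ≤ 1 := by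
    have := O.1.valuation.map_add (t - algebraMap κ K c) (algebraMap κ K c)
    rw [sub_add_cancel] at this
    exact this.trans (max_le hO.le (O.2.valuation_algebraMap_le_one c))
  have h1 := hr O hs1
  have h2 : O.1.valuation (aeval t r.num) ^ 2 * O.1.valuation (aeval t (∏ a ∈ T, (X - C a))) ≤
      O.1.valuation (aeval t r.denom) ^ 2 := by
    have h3 : aeval t r.num ^ 2 * aeval t (∏ a ∈ T, (X - C a)) =
        (r • ∏ a ∈ T, z a) ^ 2 * aeval t r.denom ^ 2 := by
      have hden : aeval t r.denom ≠ 0 := by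
        rw [← algebraMap_algebraMap_eq_aeval]
        exact (_root_.map_ne_zero _).2
          ((map_ne_zero_iff _ (RatFunc.algebraMap_injective κ)).2 (RatFunc.denom_ne_zero r))
      have hr' : algebraMap (RatFunc κ) K r = aeval t r.num / aeval t r.denom := by
        rw [← algebraMap_algebraMap_eq_aeval, ← algebraMap_algebraMap_eq_aeval, ← map_div₀,
          RatFunc.num_div_denom]
      rw [Algebra.smul_def, mul_pow, h.prod_sq hT, algebraMap_algebraMap_eq_aeval, hr']
      field_simp
    rw [← map_pow, ← map_mul, h3, map_mul, map_pow, map_pow]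
    exact mul_le_of_le_one_left' (pow_le_one₀ zero_le h1)
  rw [O.2.valuation_aeval_eq_one hO hnum, one_pow, one_mul] at h2
  obtain ⟨q, hq⟩ := dvd_iff_isRoot.2 hc
  have hts0 : 0 < O.1.valuation (t - algebraMap κ K c) := by
    rw [algebraMap_X_sub_C]
    exact (Valuation.pos_iff _).2 ((_root_.map_ne_zero _).2 (ratFunc_X_sub_C_ne_zero c))
  have hden : O.1.valuation (aeval t r.denom) ≤ O.1.valuation (t - algebraMap κ K c) := by
    rw [hq, map_mul, map_mul, map_sub, aeval_X, aeval_C]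
    exact mul_le_of_le_one_right' (O.2.valuation_aeval_le_one hs1 q)
  have hprod : O.1.valuation (t - algebraMap κ K c) ≤
      O.1.valuation (aeval t (∏ a ∈ T, (X - C a))) := by
    have hU : ∀ U : Finset κ, c ∉ U → O.1.valuation (aeval t (∏ a ∈ U, (X - C a))) = 1 := by
      intro U hU
      refine O.2.valuation_aeval_eq_one hO ?_
      rw [eval_prod, Finset.prod_ne_zero_iff]
      intro a ha
      rw [eval_sub, eval_X, eval_C, sub_ne_zero]
      rintro rfl
      exact hU ha
    by_cases hcT : c ∈ T
    · rw [← Finset.mul_prod_erase T _ hcT, map_mul, map_mul, hU _ (Finset.notMem_erase c T), mul_one,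
        map_sub (aeval (R := κ) t), aeval_X, aeval_C]
    · rw [hU T hcT]
      exact hO.le
  have h4 : O.1.valuation (aeval t r.denom) ^ 2 < O.1.valuation (t - algebraMap κ K c) := by
    refine (pow_le_pow_left₀ zero_le hden 2).trans_lt ?_
    rw [pow_two]
    exact mul_lt_of_lt_one_left hts0 hO
  exact absurd (hprod.trans h2) (not_le.2 h4)

theorem valuation_algebraMap_smul_prod_sq (h : IsSqrtTower S z) {T : Finset κ} (hT : T ⊆ S)
    (O : Pl) (p : κ[X]) :
    O.1.valuation (algebraMap κ[X] (RatFunc κ) p • ∏ a ∈ T, z a) ^ 2 =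
      O.1.valuation (aeval t (p ^ 2 * ∏ a ∈ T, (X - C a))) := by
  rw [← map_pow, Algebra.smul_def, mul_pow, h.prod_sq hT, algebraMap_algebraMap_eq_aeval,
    algebraMap_algebraMap_eq_aeval, map_mul (aeval t), map_pow (aeval t)]

theorem valuation_smul_prod_le (h : IsSqrtTower S z) {T : Finset κ} (hT : T ⊆ S) (O : Pl)
    (ht : O.1.valuation t ≤ 1) (p : κ[X]) :
    O.1.valuation (algebraMap κ[X] (RatFunc κ) p • ∏ a ∈ T, z a) ≤ 1 := by
  rw [← pow_le_one_iff_of_nonneg zero_le (_root_.two_ne_zero), h.valuation_algebraMap_smul_prod_sq hT]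
  exact O.2.valuation_aeval_le_one ht _

theorem valuation_smul_prod_le_pow_iff (h : IsSqrtTower S z) {T : Finset κ} (hT : T ⊆ S) (O : Pl)
    (ht : 1 < O.1.valuation t) {p : κ[X]} (hp : p ≠ 0) (m : ℕ) :
    O.1.valuation (algebraMap κ[X] (RatFunc κ) p • ∏ a ∈ T, z a) ≤ O.1.valuation t ^ m ↔
      2 * p.natDegree + T.card ≤ 2 * m := by
  rw [← pow_le_pow_iff_left₀ zero_le zero_le (_root_.two_ne_zero),
    h.valuation_algebraMap_smul_prod_sq hT, O.2.valuation_aeval_of_one_lt ht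
      (mul_ne_zero (pow_ne_zero 2 hp) (Finset.prod_ne_zero_iff.2 fun a _ => X_sub_C_ne_zero a)),
    natDegree_sq_mul_prod hp, ← pow_mul, pow_le_pow_iff_right₀ ht, mul_comm m]

end IsSqrtTower

end TowerRiemannRoch

section Comap

variable {F K : Type} [Field F] [Field K] [Algebra F K]

theorem valuation_le_one_comap_iff (O : ValuationSubring K) (σ : K ≃ₐ[F] K) (x : K) :
    (O.comap (σ : K →+* K)).valuation x ≤ 1 ↔ O.valuation (σ x) ≤ 1 := by
  rw [ValuationSubring.valuation_le_one_iff, ValuationSubring.valuation_le_one_iff,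
    ValuationSubring.mem_comap]
  rfl

theorem valuation_le_pow_iff {O : ValuationSubring K} {s : K} (hs : 1 < O.valuation s) (m : ℕ)
    (f : K) : O.valuation f ≤ O.valuation s ^ m ↔ O.valuation (f / s ^ m) ≤ 1 := by
  rw [map_div₀, map_pow, div_le_one₀ (pow_pos (zero_lt_one.trans hs) m)]

end Comap

section TowerPolarDivisor

open Polynomial

variable {κ K : Type} [Field κ] [Field K] [Algebra κ K] [Algebra (RatFunc κ) K]
  [IsScalarTower κ (RatFunc κ) K] {S : Finset κ} {z : κ → K}

local notation "Pl" => {O : ValuationSubring K // IsPlace κ K O}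
local notation "t" => algebraMap (RatFunc κ) K RatFunc.X

variable (S z) in
/-- The linear combinations of the products `∏ a ∈ T, z a`, `T ⊆ S`, with coefficients polynomials
in `t` of degree less than `N T`. -/
noncomputable def polynomialCombination (N : Finset κ → ℕ) :
    ((T : S.powerset) → degreeLT κ (N T)) →ₗ[κ] K :=
  ∑ T : S.powerset, ((LinearMap.toSpanSingleton (RatFunc κ) K (∏ a ∈ T.1, z a)).restrictScalars κ ∘ₗ
    (IsScalarTower.toAlgHom κ κ[X] (RatFunc κ)).toLinearMap ∘ₗ (degreeLT κ (N T)).subtype ∘ₗ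
      LinearMap.proj T)

theorem polynomialCombination_apply (N : Finset κ → ℕ)
    (p : (T : S.powerset) → degreeLT κ (N T)) :
    polynomialCombination S z N p =
      ∑ T : S.powerset, algebraMap κ[X] (RatFunc κ) (p T) • ∏ a ∈ T.1, z a := by
  simp [polynomialCombination]

namespace IsSqrtTower

theorem polynomialCombination_injective (h : IsSqrtTower S z) (N : Finset κ → ℕ) :
    Function.Injective (polynomialCombination S z N) := by
  rw [← LinearMap.ker_eq_bot, LinearMap.ker_eq_bot']
  intro p hp
  rw [polynomialCombination_apply] at hp
  have h1 := Fintype.linearIndependent_iff.1 h.linearIndepOn_prod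
    (fun T => algebraMap κ[X] (RatFunc κ) (p T)) hp
  funext T
  exact Subtype.ext ((map_eq_zero_iff _ (RatFunc.algebraMap_injective κ)).1 (h1 T))

/-- The Riemann–Roch spaces of multiples of the polar divisor of `t`. -/
theorem range_polynomialCombination [IsAlgClosed κ] (h : IsSqrtTower S z) {P : Pl →₀ ℤ}
    (hP : ∀ (O : Pl), (O.1.valuation t ≤ 1 → P O = 0) ∧
      ∀ π, IsUniformizer K O.1 π → 1 < O.1.valuation t →
        O.1.valuation t = O.1.valuation π ^ (-P O)) (m : ℕ) :
    LinearMap.range (polynomialCombination S z fun T => m + 1 - (T.card + 1) / 2) =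
      RRspace κ K ((m : ℤ) • P) := by
  classical
  have hmem := fun f : K => mem_RRspace_smul_poles h.placesRational hP m (f := f)
  refine le_antisymm ?_ fun f hf => ?_
  · rintro _ ⟨p, rfl⟩
    rw [polynomialCombination_apply]
    refine sum_mem fun T _ => ?_
    have hT : T.1 ⊆ S := Finset.mem_powerset.1 T.2
    by_cases hp : (p T : κ[X]) = 0
    · rw [hp, map_zero, zero_smul]
      exact zero_mem _
    refine (hmem _).2 fun O => ⟨fun h1 => h.valuation_smul_prod_le hT O h1 _, fun h1 => ?_⟩
    rw [h.valuation_smul_prod_le_pow_iff hT O h1 hp]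
    have h2 := (natDegree_lt_iff_degree_lt hp).2 (mem_degreeLT.1 (p T).2)
    omega
  · obtain ⟨g, hg⟩ := h.exists_eq_sum f
    have hcomp : ∀ T ∈ S.powerset, g T • ∏ a ∈ T, z a ∈ RRspace κ K ((m : ℤ) • P) := by
      intro T hT
      refine h.component_mem (RRspace κ K ((m : ℤ) • P)).toAddSubgroup (fun σ f hf => ?_)
        (fun f hf => ?_) S.powerset (fun T hT => Finset.mem_powerset.1 hT) g hT (hg ▸ hf)
      · rw [Submodule.mem_toAddSubgroup, hmem] at hf ⊢
        intro O
        have h1 := hf ⟨_, O.2.comap σ⟩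
        have ht : (O.1.comap (σ : K →+* K)).valuation t ≤ 1 ↔ O.1.valuation t ≤ 1 := by
          rw [valuation_le_one_comap_iff, σ.commutes]
        refine ⟨fun h2 => (valuation_le_one_comap_iff _ _ _).1 (h1.1 (ht.2 h2)), fun h2 => ?_⟩
        have h3 := lt_iff_lt_of_le_iff_le ht
        have h4 := (valuation_le_pow_iff (h3.2 h2) m f).1 (h1.2 (h3.2 h2))
        rwa [valuation_le_one_comap_iff, map_div₀, map_pow, σ.commutes,
          ← valuation_le_pow_iff h2] at h4
      · have h1 := (RRspace κ K ((m : ℤ) • P)).smul_mem (2⁻¹ : κ) hf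
        have h3 : (algebraMap κ K 2⁻¹) * (2 * f) = f := by
          rw [map_inv₀, map_ofNat, ← mul_assoc, inv_mul_cancel₀, one_mul]
          rw [← map_ofNat (algebraMap κ K) 2]
          exact (_root_.map_ne_zero (algebraMap κ K)).2 h.two_ne_zero
        rwa [Algebra.smul_def, h3] at h1
    have hpoly : ∀ T : S.powerset, ∃ p : degreeLT κ (m + 1 - (T.1.card + 1) / 2),
        g T = algebraMap κ[X] (RatFunc κ) p := by
      intro T
      have hT : T.1 ⊆ S := Finset.mem_powerset.1 T.2
      have h1 := (hmem _).1 (hcomp T.1 T.2)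
      obtain ⟨p, hp⟩ := h.exists_aeval_eq_of_regular hT fun O hO => (h1 O).1 hO
      refine ⟨⟨p, mem_degreeLT.2 ?_⟩, hp⟩
      by_cases hp0 : p = 0
      · rw [hp0, degree_zero]
        exact WithBot.bot_lt_coe _
      obtain ⟨O, hO⟩ := h.exists_place_one_lt_valuation
      have h2 := (h1 O).2 hO
      rw [hp, h.valuation_smul_prod_le_pow_iff hT O hO hp0] at h2
      rw [← natDegree_lt_iff_degree_lt hp0]
      omega
    choose p hp using hpoly
    refine ⟨p, ?_⟩
    rw [polynomialCombination_apply, hg, ← Finset.sum_coe_sort S.powerset fun T => g T • ∏ a ∈ T, z a]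
    exact Finset.sum_congr rfl fun T _ => by rw [hp]

end IsSqrtTower

theorem two_mul_sum_card_powerset {α : Type} [DecidableEq α] (S : Finset α) :
    2 * ∑ T ∈ S.powerset, T.card = S.card * 2 ^ S.card := by
  induction S using Finset.induction_on with
  | empty => simp
  | insert a S ha ih =>
    rw [Finset.sum_powerset_insert ha, Finset.card_insert_of_notMem ha,
      Finset.sum_congr rfl fun T hT => Finset.card_insert_of_notMem
        fun h => ha (Finset.mem_powerset.1 hT h), Finset.sum_add_distrib, Finset.sum_const,
      Finset.card_powerset, smul_eq_mul, pow_succ]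
    linarith

theorem two_mul_sum_card_add_one_div_two {α : Type} [DecidableEq α] {S : Finset α}
    (hS : S.Nonempty) :
    4 * ∑ T ∈ S.powerset, (T.card + 1) / 2 = (S.card + 1) * 2 ^ S.card := by
  obtain ⟨a, ha⟩ := hS
  rw [← Finset.insert_erase ha]
  set R := S.erase a
  have hR : a ∉ R := Finset.notMem_erase a S
  have h1 : ∑ T ∈ R.powerset, ((T.card + 1) / 2 + (T.card + 1 + 1) / 2) =
      ∑ T ∈ R.powerset, T.card + 2 ^ R.card := by
    rw [← Finset.card_powerset, Finset.card_eq_sum_ones, ← Finset.sum_add_distrib]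
    exact Finset.sum_congr rfl fun T _ => by omega
  have h2 := two_mul_sum_card_powerset R
  have h3 : ∀ T ∈ R.powerset, (T.card + 1) / 2 + (T.card + 1 + 1) / 2 =
      (T.card + 1) / 2 + ((insert a T).card + 1) / 2 := fun T hT => by
    rw [Finset.card_insert_of_notMem fun h => hR (Finset.mem_powerset.1 hT h)]
  rw [Finset.sum_powerset_insert hR, Finset.card_insert_of_notMem hR,
    ← Finset.sum_add_distrib, ← Finset.sum_congr rfl h3, h1, pow_succ]
  linarith

namespace IsSqrtTower

theorem finrank_RRspace_smul_poles [IsAlgClosed κ] (h : IsSqrtTower S z) (hS : S.Nonempty)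
    {P : Pl →₀ ℤ}
    (hP : ∀ (O : Pl), (O.1.valuation t ≤ 1 → P O = 0) ∧
      ∀ π, IsUniformizer K O.1 π → 1 < O.1.valuation t →
        O.1.valuation t = O.1.valuation π ^ (-P O)) {m : ℕ} (hm : S.card ≤ m) :
    FiniteDimensional κ (RRspace κ K ((m : ℤ) • P)) ∧
      4 * Module.finrank κ (RRspace κ K ((m : ℤ) • P)) + (S.card + 1) * 2 ^ S.card =
        4 * (2 ^ S.card * (m + 1)) := by
  classical
  have hfin : ∀ k, FiniteDimensional κ (degreeLT κ k) := fun k =>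
    (degreeLTEquiv κ k).symm.finiteDimensional
  have hrank : ∀ k, Module.finrank κ (degreeLT κ k) = k := fun k => by
    rw [(degreeLTEquiv κ k).finrank_eq, Module.finrank_fin_fun]
  rw [← h.range_polynomialCombination hP m]
  refine ⟨inferInstance, ?_⟩
  rw [LinearMap.finrank_range_of_inj (h.polynomialCombination_injective _),
    Module.finrank_pi_fintype, Finset.sum_congr rfl fun T _ => hrank _,
    Finset.sum_coe_sort S.powerset fun T => m + 1 - (T.card + 1) / 2,
    ← two_mul_sum_card_add_one_div_two hS, ← mul_add, ← Finset.sum_add_distrib,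
    Finset.sum_congr rfl (g := fun _ => m + 1), Finset.sum_const, Finset.card_powerset, smul_eq_mul]
  intro T hT
  have := Finset.card_le_card (Finset.mem_powerset.1 hT)
  omega

end IsSqrtTower

end TowerPolarDivisor

section TowerGenus

variable {κ K : Type} [Field κ] [Field K] [Algebra κ K]

local notation "Pl" => {O : ValuationSubring K // IsPlace κ K O}

theorem divDegree_sum {ι : Type} (s : Finset ι) (D : ι → Pl →₀ ℤ) :
    divDegree κ K (∑ i ∈ s, D i) = ∑ i ∈ s, divDegree κ K (D i) :=
  map_sum (AddMonoidHom.mk' (divDegree κ K) divDegree_add) D s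

theorem divDegree_sub (D E : Pl →₀ ℤ) :
    divDegree κ K (D - E) = divDegree κ K D - divDegree κ K E :=
  map_sub (AddMonoidHom.mk' (divDegree κ K) divDegree_add) D E

variable [Algebra (RatFunc κ) K] [IsScalarTower κ (RatFunc κ) K] {S : Finset κ} {z : κ → K}

local notation "t" => algebraMap (RatFunc κ) K RatFunc.X

namespace IsSqrtTower

/-- Every divisor is bounded by a divisor linearly equivalent to a large multiple of the polar
divisor of `t`. -/
theorem exists_le_smul_poles_add [IsAlgClosed κ] (h : IsSqrtTower S z) {P : Pl →₀ ℤ}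
    (hdeg : divDegree κ K P = 2 ^ S.card)
    (hP : ∀ (O : Pl), (1 < O.1.valuation t → 0 < P O) ∧ (O.1.valuation t ≤ 1 → P O = 0) ∧
      ∀ π, IsUniformizer K O.1 π → 1 < O.1.valuation t →
        O.1.valuation t = O.1.valuation π ^ (-P O)) (D : Pl →₀ ℤ) (k : ℕ) :
    ∃ (m : ℕ) (f : K) (H : Pl →₀ ℤ), k ≤ m ∧ f ≠ 0 ∧ IsDivisorOf f H ∧ divDegree κ K H = 0 ∧
      D ≤ (m : ℤ) • P + H := by
  classical
  choose c hc using fun (O : Pl) (ht : O.1.valuation t ≤ 1) => h.exists_valuation_sub_lt_one O.2 ht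
  choose Z hZdeg hZ using fun c : κ => h.exists_zeros_sub c
  let c' : Pl → κ := fun O => if ht : O.1.valuation t ≤ 1 then c O ht else 0
  let C : Finset κ := D.support.image c'
  let M : ℕ := k + ∑ O ∈ D.support, (D O).natAbs
  have hM : ∀ O, D O ≤ M := by
    intro O
    by_cases hO : O ∈ D.support
    · have := Finset.single_le_sum (f := fun O => (D O).natAbs) (fun _ _ => Nat.zero_le _) hO
      omega
    · rw [Finsupp.notMem_support_iff.1 hO]
      exact Int.natCast_nonneg M
  have hPnonneg : ∀ O, 0 ≤ P O := fun O => by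
    rcases lt_or_ge 1 (O.1.valuation t) with h1 | h1
    · exact ((hP O).1 h1).le
    · exact ((hP O).2.1 h1).ge
  have hZnonneg : ∀ c O, 0 ≤ Z c O := fun c O => by
    by_cases h1 : O.1.valuation (t - algebraMap κ K c) < 1
    · exact ((hZ c O).1 h1).le
    · exact ((hZ c O).2.1 h1).ge
  refine ⟨M * (1 + C.card), ∏ c ∈ C, (t - algebraMap κ K c) ^ M,
    ∑ c ∈ C, (M : ℤ) • (Z c - P), ?_, ?_, ?_, ?_, ?_⟩
  · exact (Nat.le_add_right _ _).trans (Nat.le_mul_of_pos_right M (by omega))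
  · refine Finset.prod_ne_zero_iff.2 fun c _ => pow_ne_zero M ?_
    rw [algebraMap_X_sub_C]
    exact (map_ne_zero _).2 (ratFunc_X_sub_C_ne_zero c)
  · exact .prod fun c _ => (isDivisorOf_sub (fun O => (hZ c O).2) fun O => (hP O).2).pow M
  · rw [divDegree_sum]
    refine Finset.sum_eq_zero fun c _ => ?_
    rw [divDegree_smul, divDegree_sub, hZdeg, hdeg, sub_self, mul_zero]
  · intro O
    have h1 : (((M * (1 + C.card) : ℕ) : ℤ) • P + ∑ c ∈ C, (M : ℤ) • (Z c - P)) O =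
        M * (P O + ∑ c ∈ C, Z c O) := by
      simp only [Finsupp.add_apply, Finsupp.smul_apply, Finsupp.finsetSum_apply,
        Finsupp.sub_apply, smul_eq_mul, ← Finset.mul_sum, Finset.sum_sub_distrib, Finset.sum_const,
        nsmul_eq_mul]
      push_cast
      ring
    rw [h1]
    have hsum := Finset.sum_nonneg fun c (_ : c ∈ C) => hZnonneg c O
    have hP0 := hPnonneg O
    by_cases hO : O ∈ D.support
    · suffices 1 ≤ P O + ∑ c ∈ C, Z c O from
        (hM O).trans (le_mul_of_one_le_right (Int.natCast_nonneg M) this)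
      rcases lt_or_ge 1 (O.1.valuation t) with h2 | h2
      · have := (hP O).1 h2
        omega
      · have h3 : c' O = c O h2 := dif_pos h2
        have h4 := (hZ (c O h2) O).1 (hc O h2)
        have h5 := Finset.single_le_sum (f := fun c => Z c O) (fun c _ => hZnonneg c O)
          (h3 ▸ Finset.mem_image_of_mem c' hO : c O h2 ∈ C)
        omega
    · rw [Finsupp.notMem_support_iff.1 hO]
      exact mul_nonneg (Int.natCast_nonneg M) (add_nonneg hP0 hsum)

theorem genusZ_eq [IsAlgClosed κ] (h : IsSqrtTower S z) (hS : 2 ≤ S.card) :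
    genusZ κ K = 2 ^ (S.card - 2) * ((S.card : ℤ) - 3) + 1 := by
  obtain ⟨P, hdeg, hP⟩ := h.exists_poles
  have hne : S.Nonempty := Finset.card_pos.1 (by omega)
  have hval : ∀ m : ℕ, S.card ≤ m → divDegree κ K ((m : ℤ) • P) -
      Module.finrank κ (RRspace κ K ((m : ℤ) • P)) + 1 =
        2 ^ (S.card - 2) * ((S.card : ℤ) - 3) + 1 := by
    intro m hm
    have h1 := (h.finrank_RRspace_smul_poles hne (fun O => (hP O).2) hm).2
    zify at h1
    have h2 : (2 : ℤ) ^ S.card = 4 * 2 ^ (S.card - 2) := by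
      conv_lhs => rw [← Nat.sub_add_cancel hS, pow_add]
      ring
    rw [divDegree_smul, hdeg]
    rw [h2] at h1 ⊢
    linarith
  refine IsGreatest.csSup_eq ⟨⟨(S.card : ℤ) • P, (hval _ le_rfl).symm⟩, ?_⟩
  rintro _ ⟨D, rfl⟩
  obtain ⟨m, f, H, hm, hf, hH, hH0, hle⟩ := h.exists_le_smul_poles_add hdeg hP D S.card
  obtain ⟨e⟩ := exists_linearEquiv_RRspace hf hH ((m : ℤ) • P)
  have := (h.finrank_RRspace_smul_poles hne (fun O => (hP O).2) hm).1
  have : FiniteDimensional κ (RRspace κ K ((m : ℤ) • P + H)) := e.symm.finiteDimensional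
  have h1 := divDegree_sub_finrank_mono h.placesRational hle
  rw [divDegree_add, hH0, add_zero, e.finrank_eq] at h1
  linarith [hval m hm]

end IsSqrtTower

end TowerGenus

section Compositum

open IntermediateField

theorem isSqrtTower_iSup_adjoin {κ Ω : Type} [Field κ] [Field Ω] [Algebra (RatFunc κ) Ω]
    (h2 : (2 : κ) ≠ 0) {y : κ → Ω}
    (hy : ∀ a, y a ^ 2 = algebraMap (RatFunc κ) Ω (1 / (RatFunc.X - RatFunc.C a)))
    (S : Finset κ) :
    ∃ z : κ → (⨆ a ∈ S, adjoin (RatFunc κ) {y a} : IntermediateField (RatFunc κ) Ω),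
      IsSqrtTower S z := by
  classical
  set L : IntermediateField (RatFunc κ) Ω := ⨆ a ∈ S, adjoin (RatFunc κ) {y a}
  have hmem : ∀ a ∈ S, y a ∈ L := fun a ha =>
    (le_iSup₂ (f := fun a (_ : a ∈ S) => adjoin (RatFunc κ) {y a}) a ha)
      (mem_adjoin_simple_self _ _)
  let z : κ → L := fun a => if ha : a ∈ S then ⟨y a, hmem a ha⟩⁻¹ else 0
  have hz : ∀ a ∈ S, (z a : Ω) = (y a)⁻¹ := fun a ha => by
    simp only [z, dif_pos ha]
    rfl
  refine ⟨z, h2, fun a ha => Subtype.ext ?_, ?_⟩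
  · rw [SubmonoidClass.coe_pow, hz a ha, inv_pow, hy, one_div, map_inv₀, inv_inv]
    rfl
  · rw [← lift_inj, lift_adjoin, lift_top]
    refine le_antisymm ?_ (iSup₂_le fun a ha => adjoin_simple_le_iff.2 ?_)
    · rw [adjoin_le_iff]
      rintro _ ⟨x, -, rfl⟩
      exact x.2
    · rw [← inv_inv (y a), ← hz a ha]
      exact inv_mem (subset_adjoin _ _ ⟨z a, ⟨a, ha, rfl⟩, rfl⟩)

end Compositum

open IntermediateField

/-- Let `κ` be an algebraically closed field of characteristic `≠ 2`,
`K₀ = κ(t)` the rational function field, and for `a ∈ κ` let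
`K_a = K₀(√(1/(t-a)))` (realized inside a fixed algebraic closure `Ω` of `K₀` by
choosing square roots `y a` of `1/(t-a)`).  If `S ⊆ κ` is a finite set of
cardinality `n ≥ 2`, then the extensions `K_a|K₀`, `a ∈ S`, are linearly
disjoint over `K₀` (their compositum `K_S` has degree `2^n` over `K₀`), and
`K_S` is a function field of one variable over `κ` of genus
`g_n = 2^{n-2}(n-3) + 1`. -/
theorem compositum_degree_and_genus {κ : Type} [Field κ] [IsAlgClosed κ]
    (h2 : ringChar κ ≠ 2)
    (y : κ → AlgebraicClosure (RatFunc κ))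
    (hy : ∀ a : κ, (y a) ^ 2 =
      algebraMap (RatFunc κ) (AlgebraicClosure (RatFunc κ))
        (1 / (RatFunc.X - RatFunc.C a)))
    (S : Finset κ) (n : ℕ) (hn : n = S.card) (hn2 : 2 ≤ n) :
    letI KS : IntermediateField (RatFunc κ) (AlgebraicClosure (RatFunc κ)) :=
      ⨆ a ∈ S, IntermediateField.adjoin (RatFunc κ) {y a}
    Module.finrank (RatFunc κ) KS = 2 ^ n ∧
      genusZ κ KS = 2 ^ (n - 2) * ((n : ℤ) - 3) + 1 := by
  subst hn
  obtain ⟨z, hz⟩ := isSqrtTower_iSup_adjoin (Ring.two_ne_zero h2) hy S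
  exact ⟨hz.finrank_eq, hz.genusZ_eq hn2⟩
end

section
/- Two fields K and L are elementarily equivalent if and only if there exist ultrapowers K* = K^I/𝒟 and L* = L^J/ℰ that are isomorphic as fields. -/
open FirstOrder Filter

namespace KeislerShelah

open Cardinal Set

/-- A well-founded recursion principle: if every partial solution of the constraints `P` can be
extended by one step, then there is a global solution. -/
theorem exists_forall_of_wellFoundedLT {ι X : Type*} [LinearOrder ι] [WellFoundedLT ι] [Nonempty X]
    (P : ι → (ι → X) → X → Prop)
    (hP : ∀ i x x', (∀ j < i, x j = x' j) → ∀ y, P i x y → P i x' y)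
    (step : ∀ i x, (∀ j < i, P j x (x j)) → ∃ y, P i x y) :
    ∃ x : ι → X, ∀ i, P i x (x i) := by
  classical
  let G : ∀ i : ι, (∀ j, j < i → X) → X := fun i r =>
    Classical.epsilon fun y => P i (fun j => if h : j < i then r j h else Classical.arbitrary X) y
  let x : ι → X := (wellFounded_lt (α := ι)).fix G
  refine ⟨x, fun i => ?_⟩
  induction i using WellFoundedLT.induction with
  | ind i ih =>
    obtain ⟨y, hy⟩ := step i x ih
    have hx : x i = G i fun j _ => x j := (wellFounded_lt (α := ι)).fix_eq G i
    have key : P i (fun j => if j < i then x j else Classical.arbitrary X) (x i) := by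
      rw [hx]
      exact Classical.epsilon_spec (p := fun y =>
        P i (fun j => if j < i then x j else Classical.arbitrary X) y)
        ⟨y, hP i _ _ (fun j hj => by simp [hj]) y hy⟩
    exact hP i _ _ (fun j hj => by simp [hj]) _ key

section Independence

variable {I C Θ : Type}

/-- The functions `F t`, `t ∈ S`, are independent over the family `D` of sets: every prescription of
the values of at most `#C` of them is attained at some point of each member of `D`. -/
def Indep (F : Θ → I → C) (D : Set (Set I)) (S : Set Θ) : Prop :=
  ∀ E ∈ D, ∀ e : C → Θ, (∀ c, e c ∈ S) → ∀ h : Θ → C, ∃ ξ ∈ E, ∀ c, F (e c) ξ = h (e c)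

/-- The Engelking–Karłowicz theorem: there are `2 ^ 2 ^ #C` independent functions on a set of
cardinality `2 ^ #C`. -/
theorem exists_indep (C : Type) [Infinite C] :
    ∃ F : Set (Set C) → ((C × C → Set C) × (C → Set (C × C)) × (C → C)) → C,
      Indep F {Set.univ} Set.univ := by
  classical
  refine ⟨fun X p => p.2.2 (Classical.epsilon fun c => p.2.1 c = p.1 ⁻¹' X), ?_⟩
  rintro E rfl e - h
  have hw : ∀ p : C × C, ∃ y : Set C, e p.1 ≠ e p.2 → ¬ (y ∈ e p.1 ↔ y ∈ e p.2) := by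
    intro p
    by_cases hp : e p.1 = e p.2
    · exact ⟨∅, fun h => absurd hp h⟩
    · by_contra! hy
      exact hp (Set.ext fun y => (hy y).2)
  choose w hw using hw
  refine ⟨(w, fun c => w ⁻¹' e c, fun c => h (e c)), mem_univ _, fun c => ?_⟩
  have := Classical.epsilon_spec (p := fun c' => w ⁻¹' e c' = w ⁻¹' e c) ⟨c, rfl⟩
  set c' := Classical.epsilon fun c' => w ⁻¹' e c' = w ⁻¹' e c
  have hcc : e c' = e c := by
    by_contra hne
    exact hw (c', c) hne (Set.ext_iff.1 this (c', c))
  exact congrArg h hcc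

/-- After removing few functions from an independent family, any remaining one can moreover be
required to take the same value as `g`. -/
theorem exists_removal_singleton [Infinite C] {F : Θ → I → C} {E : Set I} {S : Set Θ}
    (hF : Indep F {E} S) (g : I → C) :
    ∃ R : Set Θ, #R ≤ #C ∧ ∀ t ∈ S \ R, ∀ e : C → Θ, (∀ c, e c ∈ S \ R) → (∀ c, e c ≠ t) →
      ∀ h : Θ → C, ∃ ξ ∈ E, F t ξ = g ξ ∧ ∀ c, F (e c) ξ = h (e c) := by
  classical
  by_contra! H
  obtain ⟨_, _⟩ := exists_wellFoundedLT C
  let supp : Θ × (C → Θ) × (Θ → C) → Set Θ := fun x => insert x.1 (range x.2.1)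
  have hsupp : ∀ x, #(supp x) ≤ #C := fun x => by
    refine (mk_insert_le).trans ?_
    exact (add_le_add_left mk_range_le 1).trans
      (add_one_eq (aleph0_le_mk C)).le
  have hne : Nonempty (Θ × (C → Θ) × (Θ → C)) := by
    obtain ⟨t, -, e, -, -, h, -⟩ := H ∅ (by simp)
    exact ⟨t, e, h⟩
  obtain ⟨x, hx⟩ := exists_forall_of_wellFoundedLT (ι := C)
    (fun i (x : C → Θ × (C → Θ) × (Θ → C)) y =>
      (∀ t ∈ supp y, t ∈ S ∧ ∀ j < i, t ∉ supp (x j)) ∧ (∀ c, y.2.1 c ≠ y.1) ∧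
      ∀ ξ ∈ E, F y.1 ξ = g ξ → ∃ c, F (y.2.1 c) ξ ≠ y.2.2 (y.2.1 c))
    (by
      intro i x x' hx y hy
      refine ⟨fun t ht => ⟨(hy.1 t ht).1, fun j hj => hx j hj ▸ (hy.1 t ht).2 j hj⟩, hy.2⟩)
    (by
      intro i x _
      obtain ⟨t, ht, e, he, het, h, hh⟩ := H (⋃ j : Iio i, supp (x j)) (by
        refine (mk_iUnion_le _).trans ?_
        refine (mul_le_mul' (mk_set_le _) (ciSup_le' fun j => hsupp _)).trans ?_
        exact (mul_eq_self (aleph0_le_mk C)).le)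
      refine ⟨(t, e, h), ?_, het, hh⟩
      have aux : ∀ s ∈ S \ (⋃ j : Iio i, supp (x j)), s ∈ S ∧ ∀ j < i, s ∉ supp (x j) := by
        intro s hs
        exact ⟨hs.1, fun j hj hsj => hs.2 (mem_iUnion.2 ⟨⟨j, hj⟩, hsj⟩)⟩
      rintro s (rfl | ⟨c, rfl⟩)
      · exact aux _ ht
      · exact aux _ (he c))
  have huniq : ∀ {i j t}, t ∈ supp (x i) → t ∈ supp (x j) → i = j := by
    intro i j t hi hj
    rcases lt_trichotomy i j with h | h | h
    · exact absurd hi (((hx j).1 t hj).2 i h)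
    · exact h
    · exact absurd hj (((hx i).1 t hi).2 j h)
  let idx : Θ → C := fun t => Classical.epsilon fun i => t ∈ supp (x i)
  have hidx : ∀ {i t}, t ∈ supp (x i) → idx t = i := fun {i t} ht =>
    huniq (Classical.epsilon_spec (p := fun i => t ∈ supp (x i)) ⟨i, ht⟩) ht
  obtain ⟨f⟩ : Nonempty (C ≃ C × Option C) := by
    rw [← Cardinal.eq, mk_prod, mk_option]
    simp
  obtain ⟨ξ, hξ, hval⟩ := hF E rfl
    (fun c => ((f c).2.elim (x (f c).1).1 fun d => (x (f c).1).2.1 d))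
    (by
      intro c
      refine ((hx (f c).1).1 _ ?_).1
      cases (f c).2 with
      | none => exact mem_insert _ _
      | some d => exact mem_insert_of_mem _ (mem_range_self d))
    (fun t => if t = (x (idx t)).1 then idx t else (x (idx t)).2.2 t)
  obtain ⟨c, hc⟩ := (hx (g ξ)).2.2 ξ hξ (by
    have := hval (f.symm (g ξ, none))
    simpa [hidx (mem_insert _ _ : (x (g ξ)).1 ∈ supp (x (g ξ)))] using this)
  refine hc ?_
  have := hval (f.symm (g ξ, some c))
  simpa [hidx (mem_insert_of_mem _ (mem_range_self c) : (x (g ξ)).2.1 c ∈ supp (x (g ξ))),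
    (hx (g ξ)).2.1 c] using this

/-- A version of `exists_removal_singleton` for many sets and many functions at once. -/
theorem exists_removal [Infinite C] {F : Θ → I → C} {S : Set Θ} {P G : Type} (κ : Cardinal)
    (hCκ : #C ≤ κ) (hP : #P ≤ κ) (hG : #G ≤ κ) {D : P → Set I} (hF : Indep F (range D) S)
    (g : G → I → C) :
    ∃ R : Set Θ, #R ≤ κ ∧ ∀ p k, ∀ t ∈ S \ R, ∀ e : C → Θ, (∀ c, e c ∈ S \ R) → (∀ c, e c ≠ t) →
      ∀ h : Θ → C, ∃ ξ ∈ D p, F t ξ = g k ξ ∧ ∀ c, F (e c) ξ = h (e c) := by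
  have := fun q : P × G => exists_removal_singleton (F := F) (E := D q.1) (S := S)
    (by rintro E rfl; exact hF _ (mem_range_self _)) (g q.2)
  choose R hR hR' using this
  have hκ : ℵ₀ ≤ κ := (aleph0_le_mk C).trans hCκ
  refine ⟨⋃ q, R q, ?_, fun p k t ht e he het h => ?_⟩
  · refine (mk_iUnion_le _).trans ((mul_le_mul' ?_ (ciSup_le' fun q => (hR q).trans hCκ)).trans
      (mul_eq_self hκ).le)
    rw [mk_prod, lift_id, lift_id]
    exact (mul_le_mul' hP hG).trans (mul_eq_self hκ).le
  · have aux : ∀ s ∈ S \ ⋃ q, R q, s ∈ S \ R (p, k) := fun s hs =>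
      ⟨hs.1, fun h => hs.2 (mem_iUnion.2 ⟨_, h⟩)⟩
    exact hR' (p, k) t (aux t ht) e (fun c => aux _ (he c)) het h

end Independence

section BackAndForth

open Language

variable {L : FirstOrder.Language.{0, 0}} {A B I C Θ : Type} [L.Structure A] [L.Structure B]

/-- The set of coordinates at which the tuples `a` and `b` satisfy the same formulas of `s`. -/
def agree {α : Type} (a : α → I → A) (b : α → I → B) (s : Finset (L.Formula α)) : Set I :=
  {ξ | ∀ φ ∈ s, φ.Realize (fun k => a k ξ) ↔ φ.Realize (fun k => b k ξ)}

theorem agree_comm {α : Type} (a : α → I → A) (b : α → I → B) (s : Finset (L.Formula α)) :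
    agree a b s = agree b a s := by
  ext ξ
  exact forall₂_congr fun φ _ => Iff.comm

theorem mk_formula_le (hL : L.card ≤ ℵ₀) {α : Type} {κ : Cardinal} (hκ : ℵ₀ ≤ κ) (hα : #α ≤ κ) :
    #(L.Formula α) ≤ κ := by
  have h1 : #(L.Formula α) ≤ #(Σ n, L.BoundedFormula α n) :=
    mk_le_of_injective (f := fun φ : L.Formula α => (⟨0, φ⟩ : Σ n, L.BoundedFormula α n))
      fun φ ψ h => by simpa using h
  refine h1.trans (BoundedFormula.card_le.trans (max_le hκ ?_))
  simp only [lift_id]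
  exact (add_le_add hα (hL.trans hκ)).trans (add_eq_self hκ).le

theorem mk_finset_formula_le (hL : L.card ≤ ℵ₀) {α : Type} {κ : Cardinal} (hκ : ℵ₀ ≤ κ)
    (hα : #α ≤ κ) : #(Finset (L.Formula α)) ≤ κ := by
  classical
  have h1 : #(Finset (L.Formula α)) ≤ #(List (L.Formula α)) :=
    mk_le_of_surjective (f := List.toFinset) List.toFinset_surjective
  exact h1.trans ((mk_list_le_max _).trans (max_le hκ (mk_formula_le hL hκ hα)))

/-- If two tuples agree on finitely many suitable formulas, then every element on one side can be
matched with an element on the other side, as far as the formulas of `s` are concerned. -/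
theorem exists_matching {α : Type} (s : Finset (L.Formula (α ⊕ Unit))) :
    ∃ s' : Finset (L.Formula α), ∀ (v : α → A) (w : α → B),
      (∀ ψ ∈ s', ψ.Realize v ↔ ψ.Realize w) → ∀ x : A, ∃ y : B, ∀ φ ∈ s,
        φ.Realize (Sum.elim v fun _ => x) ↔ φ.Realize (Sum.elim w fun _ => y) := by
  classical
  let ψ : Finset (L.Formula (α ⊕ Unit)) → L.Formula α := fun p =>
    Formula.iExs Unit (Formula.iInf fun φ : s => if φ.1 ∈ p then φ.1 else φ.1.not)
  refine ⟨s.powerset.image ψ, fun v w h x => ?_⟩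
  have h1 := h (ψ (s.filter fun φ => φ.Realize (Sum.elim v fun _ => x)))
    (Finset.mem_image_of_mem _ (by simp))
  simp only [ψ, Formula.realize_iExs, Formula.realize_iInf] at h1
  obtain ⟨y, hy⟩ := h1.1 ⟨fun _ => x, fun φ => by
    split_ifs with hφ
    · exact (Finset.mem_filter.1 hφ).2
    · rw [Formula.realize_not]
      exact fun h => hφ (Finset.mem_filter.2 ⟨φ.2, h⟩)⟩
  have hyu : y = fun _ => y () := rfl
  refine ⟨y (), fun φ hφ => ?_⟩
  have := hy ⟨φ, hφ⟩
  rw [← hyu]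
  by_cases hx : φ.Realize (Sum.elim v fun _ => x)
  · simpa [hφ, hx] using this
  · simpa [hφ, hx] using this

theorem elim_apply_eq {M α : Type} (a : α → I → M) (a' : I → M) (ξ : I) :
    (fun k => Sum.elim a (fun _ : Unit => a') k ξ) = Sum.elim (fun k => a k ξ) fun _ => a' ξ := by
  funext k
  cases k <;> rfl

/-- The forth step: `a'` can be matched with some `b'` such that the extended tuples still agree on
large sets. -/
theorem exists_forth [Infinite C] (hL : L.card ≤ ℵ₀) {F : Θ → I → C} {S : Set Θ} {π : C → B}
    (hπ : Function.Surjective π) {α : Type} {a : α → I → A} {b : α → I → B}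
    (hF : Indep F (range (agree (L := L) a b)) S) {κ : Cardinal} (hCκ : #C ≤ κ) (hακ : #α ≤ κ)
    (hS : ∀ R : Set Θ, #R ≤ κ → (S \ R).Nonempty) (a' : I → A) :
    ∃ b' : I → B, ∃ R : Set Θ, #R ≤ κ ∧
      Indep F (range (agree (L := L) (Sum.elim a fun _ : Unit => a') (Sum.elim b fun _ => b')))
        (S \ R) := by
  classical
  have hκ : ℵ₀ ≤ κ := (aleph0_le_mk C).trans hCκ
  choose s' hs' using exists_matching (L := L) (A := A) (B := B) (α := α)
  have hg : ∀ (s : Finset (L.Formula (α ⊕ Unit))) (ξ : I), ∃ c : C, ξ ∈ agree a b (s' s) →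
      ∀ φ ∈ s, φ.Realize (Sum.elim (fun k => a k ξ) fun _ => a' ξ) ↔
        φ.Realize (Sum.elim (fun k => b k ξ) fun _ => π c) := by
    intro s ξ
    by_cases hξ : ξ ∈ agree a b (s' s)
    · obtain ⟨y, hy⟩ := hs' s _ _ hξ (a' ξ)
      obtain ⟨c, rfl⟩ := hπ y
      exact ⟨c, fun _ => hy⟩
    · exact ⟨Classical.arbitrary C, fun h => absurd h hξ⟩
  choose g hg using hg
  obtain ⟨R, hR, hR'⟩ := exists_removal κ hCκ (mk_finset_formula_le hL hκ hακ)
    (mk_finset_formula_le hL hκ (α := α ⊕ Unit) (by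
      rw [mk_sum, lift_id, lift_id, mk_unit]
      exact (add_le_add hακ (one_le_aleph0.trans hκ)).trans (add_eq_self hκ).le)) hF g
  obtain ⟨t, ht⟩ := hS R hR
  refine ⟨fun ξ => π (F t ξ), insert t R, ?_, ?_⟩
  · exact mk_insert_le.trans
      ((add_le_add hR (one_le_aleph0.trans hκ)).trans (add_eq_self hκ).le)
  · rintro _ ⟨s, rfl⟩ e he h
    obtain ⟨ξ, hξ, hgξ, hval⟩ := hR' (s' s) s t ht e
      (fun c => ⟨(he c).1, fun h => (he c).2 (mem_insert_of_mem _ h)⟩)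
      (fun c h => (he c).2 (h ▸ mem_insert _ _)) h
    refine ⟨ξ, fun φ hφ => ?_, hval⟩
    rw [elim_apply_eq, elim_apply_eq, hgξ]
    exact hg s ξ hξ φ hφ

/-- Finitely many formulas involve only finitely many variables, so agreement on them follows from
agreement on formulas whose variables are bounded by one of the indices. -/
theorem exists_agree_subset (hAB : A ≅[L] B) {ι α : Type} [LinearOrder ι] (ind : α → ι)
    (a : ι → I → A) (b : ι → I → B) (s : Finset (L.Formula α)) :
    agree (fun k => a (ind k)) (fun k => b (ind k)) s = Set.univ ∨
      ∃ (x : α) (s' : Finset (L.Formula (Iio (ind x) ⊕ Unit))),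
        agree (Sum.elim (fun k : Iio (ind x) => a k) fun _ => a (ind x))
          (Sum.elim (fun k : Iio (ind x) => b k) fun _ => b (ind x)) s' ⊆
        agree (fun k => a (ind k)) (fun k => b (ind k)) s := by
  classical
  let V : Finset α := s.biUnion fun φ => φ.freeVarFinset
  rcases V.eq_empty_or_nonempty with hV | hV
  · left
    refine eq_univ_of_forall fun ξ φ hφ => ?_
    have hφV : ∀ k ∈ φ.freeVarFinset, False := fun k hk => by
      have : k ∈ V := Finset.mem_biUnion.2 ⟨φ, hφ, hk⟩
      simp [hV] at this
    let f : φ.freeVarFinset → Empty := fun k => (hφV k k.2).elim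
    have h1 := BoundedFormula.realize_restrictFreeVar (φ := φ) (f := f) (M := A) (v := default)
      (xs := default) (fun k => a (ind k) ξ) (fun k => (f k).elim)
    have h2 := BoundedFormula.realize_restrictFreeVar (φ := φ) (f := f) (M := B) (v := default)
      (xs := default) (fun k => b (ind k) ξ) (fun k => (f k).elim)
    exact h1.symm.trans ((hAB.realize_sentence (φ.restrictFreeVar f)).trans h2)
  · right
    obtain ⟨x, -, hx⟩ := V.exists_max_image ind hV
    let f : α → Iio (ind x) ⊕ Unit := fun k =>
      if hk : ind k < ind x then Sum.inl ⟨ind k, hk⟩ else Sum.inr ()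
    have hf : ∀ {M : Type} (m : ι → I → M) (ξ : I), ∀ k ∈ V,
        Sum.elim (fun k : Iio (ind x) => m k) (fun _ => m (ind x)) (f k) ξ = m (ind k) ξ := by
      intro M m ξ k hk
      by_cases h : ind k < ind x
      · simp [f, h]
      · simp [f, le_antisymm (hx k hk) (not_lt.1 h)]
    refine ⟨x, s.image fun φ => φ.restrictFreeVar fun k => f k, fun ξ hξ φ hφ => ?_⟩
    have hφV : ∀ k : φ.freeVarFinset, (k : α) ∈ V := fun k => Finset.mem_biUnion.2 ⟨φ, hφ, k.2⟩
    have h0 := hξ _ (Finset.mem_image_of_mem _ hφ)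
    have h1 := BoundedFormula.realize_restrictFreeVar (φ := φ) (f := fun k => f k) (M := A)
      (v := fun k => Sum.elim (fun k : Iio (ind x) => a k) (fun _ => a (ind x)) k ξ)
      (xs := default) (fun k => a (ind k) ξ) (fun k => hf a ξ k (hφV k))
    have h2 := BoundedFormula.realize_restrictFreeVar (φ := φ) (f := fun k => f k) (M := B)
      (v := fun k => Sum.elim (fun k : Iio (ind x) => b k) (fun _ => b (ind x)) k ξ)
      (xs := default) (fun k => b (ind k) ξ) (fun k => hf b ξ k (hφV k))
    exact h1.symm.trans (h0.trans h2)

theorem Indep.mono {F : Θ → I → C} {D D' : Set (Set I)} {S S' : Set Θ} (hF : Indep F D S)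
    (hD : ∀ E' ∈ D', ∃ E ∈ D, E ⊆ E') (hS : S' ⊆ S) : Indep F D' S' := by
  intro E' hE' e he h
  obtain ⟨E, hE, hEE'⟩ := hD E' hE'
  obtain ⟨ξ, hξ, hv⟩ := hF E hE e (fun c => hS (he c)) h
  exact ⟨ξ, hEE' hξ, hv⟩

/-- The transfinite back-and-forth construction. -/
theorem exists_enumerations (hL : L.card ≤ ℵ₀) (hAB : A ≅[L] B) [Infinite C] {F : Θ → I → C}
    (hF : Indep F {Set.univ} Set.univ) {π : C → A} (hπ : Function.Surjective π) {ρ : C → B}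
    (hρ : Function.Surjective ρ) (hCΘ : #C < #Θ) (hA : #(I → A) ≤ #Θ) (hB : #(I → B) ≤ #Θ) :
    ∃ (a : Θ → I → A) (b : Θ → I → B), Function.Surjective a ∧ Function.Surjective b ∧
      ∀ s : Finset (L.Formula Θ), (agree a b s).Nonempty := by
  classical
  have hC : ℵ₀ ≤ #C := aleph0_le_mk C
  have hΘ : ℵ₀ ≤ #Θ := hC.trans hCΘ.le
  obtain ⟨c₀⟩ : Nonempty C := inferInstance
  obtain ⟨_, _, hord⟩ := exists_ord_eq_type_lt Θ
  obtain ⟨task, htask⟩ : ∃ f : Θ → (I → A) ⊕ (I → B), Function.Surjective f := by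
    have : #((I → A) ⊕ (I → B)) ≤ #Θ := by
      rw [mk_sum, lift_id, lift_id]
      exact (add_le_add hA hB).trans (add_eq_self hΘ).le
    obtain ⟨f⟩ := this
    have : Nonempty ((I → A) ⊕ (I → B)) := ⟨Sum.inl fun _ => π c₀⟩
    exact ⟨_, Function.invFun_surjective f.injective⟩
  let X := (I → A) × (I → B) × Set Θ
  have hX : Nonempty X := ⟨(fun _ => π c₀, fun _ => ρ c₀, ∅)⟩
  obtain ⟨x, hx⟩ := exists_forall_of_wellFoundedLT (ι := Θ) (X := X)
    (fun i x y => #y.2.2 ≤ max #(Iio i) #C ∧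
      (task i).elim (fun a' => y.1 = a') (fun b' => y.2.1 = b') ∧
      Indep F (range (agree (L := L) (Sum.elim (fun k : Iio i => (x k).1) fun _ : Unit => y.1)
        (Sum.elim (fun k : Iio i => (x k).2.1) fun _ => y.2.1)))
        ((⋃ k : Iio i, (x k).2.2)ᶜ \ y.2.2) ∧ ((⋃ k : Iio i, (x k).2.2)ᶜ \ y.2.2).Nonempty)
    (by
      intro i x x' hx y hy
      have h1 : (fun k : Iio i => (x k).1) = fun k : Iio i => (x' k).1 :=
        funext fun k => congrArg _ (hx k k.2)
      have h2 : (fun k : Iio i => (x k).2.1) = fun k : Iio i => (x' k).2.1 :=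
        funext fun k => congrArg (fun z : X => z.2.1) (hx k k.2)
      have h3 : (fun k : Iio i => (x k).2.2) = fun k : Iio i => (x' k).2.2 :=
        funext fun k => congrArg (fun z : X => z.2.2) (hx k k.2)
      rw [← h1, ← h2, ← h3]
      exact hy)
    (by
      intro i x ih
      have hind : Indep F (range (agree (L := L) (fun k : Iio i => (x k).1)
          (fun k : Iio i => (x k).2.1))) (⋃ k : Iio i, (x k).2.2)ᶜ := by
        rintro _ ⟨s, rfl⟩
        rcases exists_agree_subset hAB (Subtype.val : Iio i → Θ) (fun k => (x k).1)
          (fun k => (x k).2.1) s with h | ⟨j, s', h⟩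
        · rw [h]
          exact hF.mono (D' := {_}) (by rintro _ rfl; exact ⟨_, rfl, subset_rfl⟩)
            (subset_univ _) _ rfl
        · refine (ih j j.2).2.2.1.mono (D' := {_}) ?_ ?_ _ rfl
          · rintro _ rfl
            exact ⟨_, mem_range_self s', h⟩
          · intro t ht
            refine ⟨fun h => ht ?_, fun h => ht (mem_iUnion.2 ⟨j, h⟩)⟩
            obtain ⟨k, hk⟩ := mem_iUnion.1 h
            exact mem_iUnion.2 ⟨⟨k, k.2.trans j.2⟩, hk⟩
      have hκ : ℵ₀ ≤ max #(Iio i) #C := hC.trans (le_max_right _ _)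
      have hS : ∀ R : Set Θ, #R ≤ max #(Iio i) #C →
          ((⋃ k : Iio i, (x k).2.2)ᶜ \ R).Nonempty := by
        intro R hR
        have hU : #(⋃ k : Iio i, (x k).2.2 : Set Θ) ≤ max #(Iio i) #C := by
          refine (mk_iUnion_le _).trans ((mul_le_mul' (le_max_left _ _)
            (ciSup_le' fun k : Iio i => (ih k k.2).1.trans ?_)).trans (mul_eq_self hκ).le)
          exact max_le_max (mk_le_mk_of_subset (Iio_subset_Iio k.2.le)) le_rfl
        by_contra hne
        have huniv : (⋃ k : Iio i, (x k).2.2) ∪ R = Set.univ := by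
          refine eq_univ_of_forall fun t => ?_
          by_contra ht
          exact hne ⟨t, fun h => ht (Or.inl h), fun h => ht (Or.inr h)⟩
        have hlt : #Θ ≤ max #(Iio i) #C := by
          rw [← mk_univ, ← huniv]
          exact (mk_union_le _ _).trans ((add_le_add hU hR).trans (add_eq_self hκ).le)
        exact (hlt.trans_lt (max_lt (mk_Iio_lt i hord) hCΘ)).false
      cases hi : task i with
      | inl a' =>
        obtain ⟨b', R, hR, hR'⟩ := exists_forth hL hρ hind (le_max_right _ _) (le_max_left _ _)
          hS a'
        exact ⟨(a', b', R), hR, rfl, hR', hS R hR⟩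
      | inr b' =>
        obtain ⟨a', R, hR, hR'⟩ := exists_forth hL hπ (hind.mono (by
          rintro _ ⟨s, rfl⟩
          exact ⟨_, mem_range_self s, (agree_comm _ _ s).le⟩) subset_rfl)
          (le_max_right _ _) (le_max_left _ _) hS b'
        refine ⟨(a', b', R), hR, rfl, hR'.mono ?_ subset_rfl, hS R hR⟩
        rintro _ ⟨s, rfl⟩
        exact ⟨_, mem_range_self s, (agree_comm _ _ s).le⟩)
  refine ⟨fun i => (x i).1, fun i => (x i).2.1, fun a' => ?_, fun b' => ?_, fun s => ?_⟩
  · obtain ⟨i, hi⟩ := htask (Sum.inl a')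
    exact ⟨i, by simpa [hi] using (hx i).2.1⟩
  · obtain ⟨i, hi⟩ := htask (Sum.inr b')
    exact ⟨i, by simpa [hi] using (hx i).2.1⟩
  · rcases exists_agree_subset hAB id (fun k => (x k).1) (fun k => (x k).2.1) s with h | ⟨j, s', h⟩
    · obtain ⟨t⟩ : Nonempty Θ := (infinite_iff.2 hΘ).nonempty
      obtain ⟨ξ, -, -⟩ := hF _ rfl (fun _ => t) (fun _ => mem_univ _) fun _ => c₀
      exact ⟨ξ, h.ge (mem_univ ξ)⟩
    · obtain ⟨-, -, hj, t, ht⟩ := hx j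
      obtain ⟨ξ, hξ, -⟩ := hj _ (mem_range_self s') (fun _ => t) (fun _ => ht) fun _ => c₀
      exact ⟨ξ, h hξ⟩

/-- A form of the Keisler–Shelah theorem: two elementarily equivalent structures have ultrapowers,
with respect to the same ultrafilter, all of whose elements can be enumerated in such a way that
the two enumerations satisfy the same formulas. -/
theorem exists_ultrafilter (hL : L.card ≤ ℵ₀) (hAB : A ≅[L] B) [Nonempty A] [Nonempty B] :
    ∃ (I Θ : Type) (U : Ultrafilter I) (a : Θ → I → A) (b : Θ → I → B),
      Function.Surjective a ∧ Function.Surjective b ∧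
      ∀ φ : L.Formula Θ, ∀ᶠ ξ in U,
        φ.Realize (fun k => a k ξ) ↔ φ.Realize (fun k => b k ξ) := by
  classical
  let C := A × B × ℕ
  have hC : ℵ₀ ≤ #C := aleph0_le_mk C
  obtain ⟨F, hF⟩ := exists_indep C
  have hI : #((C × C → Set C) × (C → Set (C × C)) × (C → C)) ≤ 2 ^ #C := by
    have h2 : ℵ₀ ≤ (2 : Cardinal) ^ #C := hC.trans (cantor _).le
    have h1 : (#C) ^ #C ≤ 2 ^ #C := (power_self_eq hC).le
    simp only [mk_prod, mk_set, lift_id, ← power_def, mul_eq_self hC, ← power_mul]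
    exact (mul_le_mul' le_rfl ((mul_le_mul' le_rfl h1).trans (mul_eq_self h2).le)).trans
      (mul_eq_self h2).le
  have hpow : ∀ M : Type, #M ≤ #C →
      #(((C × C → Set C) × (C → Set (C × C)) × (C → C)) → M) ≤ #(Set (Set C)) := by
    intro M hM
    rw [← power_def, mk_set, mk_set]
    have h2 : #C ≤ (2 : Cardinal) ^ #C := (cantor _).le
    calc #M ^ #((C × C → Set C) × (C → Set (C × C)) × (C → C))
        ≤ ((2 : Cardinal) ^ #C) ^ ((2 : Cardinal) ^ #C) :=
          (power_le_power_right (hM.trans h2)).trans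
            (power_le_power_left (Cardinal.power_ne_zero _ two_ne_zero) hI)
      _ = 2 ^ (2 : Cardinal) ^ #C := power_self_eq (hC.trans h2)
  have hπ : Function.Surjective (Prod.fst : C → A) := Prod.fst_surjective
  have hρ : Function.Surjective (fun c : C => c.2.1) :=
    Prod.fst_surjective.comp Prod.snd_surjective
  obtain ⟨a, b, ha, hb, hab⟩ := exists_enumerations hL hAB hF hπ hρ
    (by simpa only [mk_set] using (cantor _).trans (cantor _))
    (hpow A (mk_le_of_surjective hπ)) (hpow B (mk_le_of_surjective hρ))
  obtain ⟨U, hU⟩ := Ultrafilter.exists_ultrafilter_of_finite_inter_nonempty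
    (range fun φ : L.Formula (Set (Set C)) => agree a b {φ}) (by
      intro T hT
      rw [← image_univ] at hT
      obtain ⟨s, -, rfl⟩ := Finset.subset_set_image_iff.1 hT
      obtain ⟨ξ, hξ⟩ := hab s
      refine ⟨ξ, ?_⟩
      simp only [Finset.coe_image, sInter_image, mem_iInter]
      intro φ hφ ψ hψ
      rw [Finset.mem_singleton.1 hψ]
      exact hξ φ hφ)
  refine ⟨_, _, U, a, b, ha, hb, fun φ => ?_⟩
  filter_upwards [hU (mem_range_self φ)] with ξ hξ
  exact hξ φ (Finset.mem_singleton_self φ)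

end BackAndForth
section Ring

variable {K L : Type} [Field K] [Field L]

theorem nonempty_ringEquiv_germ {I Θ : Type} {U : Ultrafilter I} {a : Θ → I → K} {b : Θ → I → L}
    (ha : Function.Surjective a) (hb : Function.Surjective b)
    (heq : ∀ i j, (∀ᶠ ξ in U, a i ξ = a j ξ) ↔ ∀ᶠ ξ in U, b i ξ = b j ξ)
    (hadd : ∀ i j k, (∀ᶠ ξ in U, a i ξ + a j ξ = a k ξ) → ∀ᶠ ξ in U, b i ξ + b j ξ = b k ξ)
    (hmul : ∀ i j k, (∀ᶠ ξ in U, a i ξ * a j ξ = a k ξ) → ∀ᶠ ξ in U, b i ξ * b j ξ = b k ξ) :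
    Nonempty (Germ (U : Filter I) K ≃+* Germ (U : Filter I) L) := by
  have hsurj : ∀ x : Germ (U : Filter I) K, ∃ i, (a i : Germ (U : Filter I) K) = x := by
    intro x
    induction x using Germ.inductionOn with
    | h f =>
      obtain ⟨i, rfl⟩ := ha f
      exact ⟨i, rfl⟩
  choose σ hσ using hsurj
  let f : Germ (U : Filter I) K → Germ (U : Filter I) L := fun x => (b (σ x) : Germ _ L)
  have hf : ∀ i, f (a i : Germ (U : Filter I) K) = (b i : Germ (U : Filter I) L) := fun i =>
    Germ.coe_eq.2 ((heq _ _).1 (Germ.coe_eq.1 (hσ _)))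
  have hbij : Function.Bijective f := by
    constructor
    · intro x y hxy
      obtain ⟨i, rfl⟩ : ∃ i, (a i : Germ (U : Filter I) K) = x := ⟨_, hσ x⟩
      obtain ⟨j, rfl⟩ : ∃ j, (a j : Germ (U : Filter I) K) = y := ⟨_, hσ y⟩
      rw [hf, hf] at hxy
      exact Germ.coe_eq.2 ((heq _ _).2 (Germ.coe_eq.1 hxy))
    · intro y
      induction y using Germ.inductionOn with
      | h g =>
        obtain ⟨i, rfl⟩ := hb g
        exact ⟨_, hf i⟩
  refine ⟨{ Equiv.ofBijective f hbij with map_mul' := fun x y => ?_, map_add' := fun x y => ?_ }⟩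
  · change f (x * y) = f x * f y
    have h1 := hmul (σ x) (σ y) (σ (x * y)) (Germ.coe_eq.1 (by
      rw [hσ (x * y)]
      exact congrArg₂ (· * ·) (hσ x) (hσ y)))
    exact (Germ.coe_eq.2 h1).symm
  · change f (x + y) = f x + f y
    have h1 := hadd (σ x) (σ y) (σ (x + y)) (Germ.coe_eq.1 (by
      rw [hσ (x + y)]
      exact congrArg₂ (· + ·) (hσ x) (hσ y)))
    exact (Germ.coe_eq.2 h1).symm

open Language FirstOrder.Ring

/-- A field is elementarily equivalent to its ultrapowers. -/
theorem elementarilyEquivalent_germ {I : Type} (U : Ultrafilter I) :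
    letI := compatibleRingOfRing K
    letI := compatibleRingOfRing (Germ (U : Filter I) K)
    K ≅[Language.ring] Germ (U : Filter I) K := by
  let _ := compatibleRingOfRing K
  let _ := compatibleRingOfRing (Germ (U : Filter I) K)
  have h1 : K ≅[Language.ring] (U : Filter I).Product fun _ => K := by
    refine elementarilyEquivalent_iff.2 fun φ => ?_
    rw [Ultraproduct.sentence_realize, eventually_const]
  let e : Language.ring.Equiv ((U : Filter I).Product fun _ => K) (Germ (U : Filter I) K) :=
    { Equiv.refl (Germ (U : Filter I) K) with
      map_fun' := fun {n} f x => by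
        have hx : ∃ y : Fin n → I → K,
            x = fun i => @Quotient.mk' _ (productSetoid (U : Filter I) fun _ => K) (y i) :=
          ⟨fun i => (x i).out, funext fun i => (Quotient.out_eq' (x i)).symm⟩
        obtain ⟨y, rfl⟩ := hx
        refine (Ultraproduct.funMap_cast (u := U) (M := fun _ => K) f y).trans ?_
        cases f <;> rfl
      map_rel' := fun {n} r => by cases r }
  exact h1.trans (StrongHomClass.elementarilyEquivalent e)

end Ring

end KeislerShelah

/-- Keisler–Shelah for fields: two fields `K` and `L` are elementarily
equivalent (in the first-order language of rings) if and only if there exist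
ultrapowers `K* = K^I/𝒟` and `L* = L^J/ℰ` that are isomorphic as fields. -/
theorem elementarilyEquivalent_iff_ultrapowers_isomorphic
    {K L : Type} [Field K] [Field L] :
    (letI := Ring.compatibleRingOfRing K
     letI := Ring.compatibleRingOfRing L
     K ≅[Language.ring] L) ↔
    ∃ (I J : Type) (𝒟 : Ultrafilter I) (ℰ : Ultrafilter J),
      Nonempty ((Filter.Germ (𝒟 : Filter I) K) ≃+* (Filter.Germ (ℰ : Filter J) L)) := by
  let _ := Ring.compatibleRingOfRing K
  let _ := Ring.compatibleRingOfRing L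
  constructor
  · intro h
    obtain ⟨I, Θ, U, a, b, ha, hb, hab⟩ := KeislerShelah.exists_ultrafilter
      (by rw [Ring.card_ring]; exact Cardinal.natCast_le_aleph0 (n := 5)) h
    have key : ∀ t₁ t₂ : Language.ring.Term Θ,
        (∀ᶠ ξ in U, t₁.realize (fun k => a k ξ) = t₂.realize fun k => a k ξ) ↔
          ∀ᶠ ξ in U, t₁.realize (fun k => b k ξ) = t₂.realize fun k => b k ξ := fun t₁ t₂ =>
      eventually_congr (by simpa only [Language.Formula.realize_equal] using hab (t₁.equal t₂))
    refine ⟨I, I, U, U, KeislerShelah.nonempty_ringEquiv_germ ha hb (fun i j => ?_)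
      (fun i j k => ?_) (fun i j k => ?_)⟩
    · simpa using key (.var i) (.var j)
    · simpa using (key (.var i + .var j) (.var k)).1
    · simpa using (key (.var i * .var j) (.var k)).1
  · rintro ⟨I, J, 𝒟, ℰ, ⟨e⟩⟩
    let _ := Ring.compatibleRingOfRing (Germ (𝒟 : Filter I) K)
    let _ := Ring.compatibleRingOfRing (Germ (ℰ : Filter J) L)
    have h : Germ (𝒟 : Filter I) K ≅[Language.ring] Germ (ℰ : Filter J) L :=
      Language.StrongHomClass.elementarilyEquivalent (Ring.languageEquivEquivRingEquiv.symm e)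
    exact (KeislerShelah.elementarilyEquivalent_germ 𝒟).trans
      (h.trans (KeislerShelah.elementarilyEquivalent_germ ℰ).symm)
end
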